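/- arXiv:2310.05248 — 6 statements merged into one kernel-verified Lean document; each statement's English description precedes it below -/
import Mathlib

section
/- Let d be a positive integer and let G be an (X,Y)-bigraph with maximum degree at most d in which every cycle has length at least 4ed² + 1 (girth at least 4ed² + 1). Suppose there exists a collection of pairwise vertex-disjoint cycles of G whose vertex sets together contain every vertex of X. Then G has a path X-cover consisting of at most α_Λ(G) paths. -/
open Finset SimpleGraph
open scoped Classical

variable {V : Type*}

/-- `Λ_G(S)`: the set of vertices of `Y` having at least two neighbors in `S`. -/
noncomputable def lamSet (G : SimpleGraph V) (Y S : Finset V) : Finset V :=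
  Y.filter fun y => 1 < (S.filter fun x => G.Adj y x).card

/-- `def(G,S)`: the Λ-deficiency of the set `S`, namely `|S| - |Λ_G(S)|`. -/
noncomputable def lamDefSet (G : SimpleGraph V) (Y S : Finset V) : ℤ :=
  (S.card : ℤ) - ((lamSet G Y S).card : ℤ)

/-- `def(G)`: the Λ-deficiency of the bigraph, `max_{S ⊆ X} def(G,S)`. -/
noncomputable def lamDef (G : SimpleGraph V) (X Y : Finset V) : ℤ :=
  X.powerset.sup' (Finset.powerset_nonempty X) fun S => lamDefSet G Y S

/-- `α_Λ(G)`: the maximum size of a Λ-independent subset of `X`. -/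
noncomputable def alphaLam (G : SimpleGraph V) (X Y : Finset V) : ℕ :=
  (X.powerset.filter fun S => lamSet G Y S = ∅).sup Finset.card

/-- `G` is an `(X,Y)`-bigraph: `X, Y` partition the vertex set and every edge
joins a vertex of `X` to a vertex of `Y`. -/
def IsBigraph (G : SimpleGraph V) (X Y : Finset V) : Prop :=
  Disjoint X Y ∧ (∀ v, v ∈ X ∨ v ∈ Y) ∧
    ∀ ⦃u v⦄, G.Adj u v → (u ∈ X ∧ v ∈ Y) ∨ (u ∈ Y ∧ v ∈ X)

/-- `P` is a path `X`-cover: a list of pairwise vertex-disjoint paths of `G`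
whose vertex sets together contain every vertex of `X`. -/
def IsPathXCover (G : SimpleGraph V) (X : Finset V)
    (P : List (Σ u : V, Σ v : V, G.Walk u v)) : Prop :=
  (∀ p ∈ P, p.2.2.IsPath) ∧
    P.Pairwise (fun p q => ∀ w : V, w ∈ p.2.2.support → w ∉ q.2.2.support) ∧
    ∀ x ∈ X, ∃ p ∈ P, x ∈ p.2.2.support

/-- `P` is a set of pairwise vertex-disjoint paths of `G` whose union of vertex
sets intersects `X` exactly in `S`. -/
def IsPathExactCover (G : SimpleGraph V) (X S : Finset V)
    (P : List (Σ u : V, Σ v : V, G.Walk u v)) : Prop :=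
  (∀ p ∈ P, p.2.2.IsPath) ∧
    P.Pairwise (fun p q => ∀ w : V, w ∈ p.2.2.support → w ∉ q.2.2.support) ∧
    ∀ x ∈ X, ((∃ p ∈ P, x ∈ p.2.2.support) ↔ x ∈ S)

/-- `C` is a collection of pairwise vertex-disjoint cycles of `G` whose vertex
sets together contain every vertex of `X`. -/
def IsCycleXCover (G : SimpleGraph V) (X : Finset V)
    (C : List (Σ u : V, G.Walk u u)) : Prop :=
  (∀ c ∈ C, c.2.IsCycle) ∧
    C.Pairwise (fun c d => ∀ w : V, w ∈ c.2.support → w ∉ d.2.support) ∧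
    ∀ x ∈ X, ∃ c ∈ C, x ∈ c.2.support

/-- The independent partial transversals on the index set `S`, for the parts `A` and the conflict
relation given by the neighborhoods `N`; coordinates outside `S` take the default value `a`. -/
noncomputable def partialTransversals {ι α : Type*} [Fintype ι] (A : ι → Finset α)
    (N : α → Finset α) (a : α) (S : Finset ι) : Finset (ι → α) :=
  (Fintype.piFinset fun i => if i ∈ S then A i else {a}).filter
    fun f => ∀ i ∈ S, ∀ j ∈ S, i ≠ j → f j ∉ N (f i)

section Transversal

variable {ι α : Type*} [Fintype ι] {A : ι → Finset α} {N : α → Finset α} {a : α}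

theorem mem_partialTransversals {S : Finset ι} {f : ι → α} :
    f ∈ partialTransversals A N a S ↔ (∀ i ∈ S, f i ∈ A i) ∧ (∀ i ∉ S, f i = a) ∧
      ∀ i ∈ S, ∀ j ∈ S, i ≠ j → f j ∉ N (f i) := by
  simp only [partialTransversals, mem_filter, Fintype.mem_piFinset]
  constructor
  · rintro ⟨h, h'⟩
    exact ⟨fun i hi => by simpa [hi] using h i, fun i hi => by simpa [hi] using h i, h'⟩
  · rintro ⟨h1, h2, h3⟩
    refine ⟨fun i => ?_, h3⟩
    by_cases hi : i ∈ S
    · simpa [hi] using h1 i hi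
    · simpa [hi] using h2 i hi

/-- Resetting the coordinate `j` maps the transversals with `f j = u` injectively into the
transversals on `S.erase j`. -/
theorem card_filter_apply_eq_le (S : Finset ι) (j : ι) (u : α) :
    ((partialTransversals A N a S).filter fun f => f j = u).card ≤
      (partialTransversals A N a (S.erase j)).card := by
  refine card_le_card_of_injOn (fun f => Function.update f j a) ?_ ?_
  · intro f hf
    have hf := (mem_filter.1 (mem_coe.1 hf)).1
    obtain ⟨h1, h2, h3⟩ := mem_partialTransversals.1 hf
    refine mem_coe.2 (mem_partialTransversals.2 ⟨?_, ?_, ?_⟩)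
    · intro i hi
      obtain ⟨hij, hi⟩ := mem_erase.1 hi
      simpa [hij] using h1 i hi
    · intro i hi
      by_cases hij : i = j
      · subst hij; simp
      · simpa [hij] using h2 i fun h => hi (mem_erase.2 ⟨hij, h⟩)
    · intro i hi k hk hik
      obtain ⟨hij, hi⟩ := mem_erase.1 hi
      obtain ⟨hkj, hk⟩ := mem_erase.1 hk
      simpa [hij, hkj] using h3 i hi k hk hik
  · intro f hf g hg hfg
    have hf := (mem_filter.1 (mem_coe.1 hf)).2
    have hg := (mem_filter.1 (mem_coe.1 hg)).2
    funext i
    by_cases hij : i = j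
    · subst hij; rw [hf, hg]
    · simpa [hij] using congrFun hfg i

/-- Extending the transversals on `S` by the elements of `A i` that create no conflict. -/
theorem sum_card_extensions_le (hsymm : ∀ u v, u ∈ N v → v ∈ N u) {S : Finset ι} {i : ι}
    (hi : i ∉ S) :
    ∑ v ∈ A i, ((partialTransversals A N a S).filter fun f => ∀ j ∈ S, f j ∉ N v).card ≤
      (partialTransversals A N a (insert i S)).card := by
  rw [← card_sigma]
  refine card_le_card_of_injOn (fun p => Function.update p.2 i p.1) ?_ ?_
  · rintro ⟨v, f⟩ hp
    obtain ⟨hv, hf⟩ := mem_sigma.1 (mem_coe.1 hp)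
    obtain ⟨hf, hN⟩ := mem_filter.1 hf
    obtain ⟨h1, h2, h3⟩ := mem_partialTransversals.1 hf
    refine mem_coe.2 (mem_partialTransversals.2 ⟨?_, ?_, ?_⟩)
    · intro k hk
      by_cases hki : k = i
      · subst hki; simpa using hv
      · simpa [hki] using h1 k ((mem_insert.1 hk).resolve_left hki)
    · intro k hk
      rw [mem_insert, not_or] at hk
      simpa [hk.1] using h2 k hk.2
    · intro k hk l hl hkl
      by_cases hki : k = i
      · subst hki
        have hlk : l ≠ k := hkl.symm
        simpa [hlk] using hN l ((mem_insert.1 hl).resolve_left hlk)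
      · have hkS := (mem_insert.1 hk).resolve_left hki
        by_cases hli : l = i
        · subst hli
          simpa [hki] using fun h => hN k hkS (hsymm _ _ h)
        · simpa [hki, hli] using h3 k hkS l ((mem_insert.1 hl).resolve_left hli) hkl
  · rintro ⟨v, f⟩ hp ⟨w, g⟩ hq hfg
    have hf := (mem_filter.1 (mem_sigma.1 (mem_coe.1 hp)).2).1
    have hg := (mem_filter.1 (mem_sigma.1 (mem_coe.1 hq)).2).1
    have hvw : v = w := by simpa using congrFun hfg i
    have hfg' : f = g := by
      funext k
      by_cases hki : k = i
      · subst hki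
        exact ((mem_partialTransversals.1 hf).2.1 k hi).trans
          ((mem_partialTransversals.1 hg).2.1 k hi).symm
      · simpa [hki] using congrFun hfg k
    rw [hvw, hfg']

/-- Adding one part multiplies the number of independent partial transversals by at least `2 * D`,
provided that all parts have size at least `4 * D` and all neighborhoods size at most `D`. -/
theorem mul_card_partialTransversals_le {D : ℕ} (hD : 0 < D)
    (hsymm : ∀ u v, u ∈ N v → v ∈ N u) (hN : ∀ v, (N v).card ≤ D)
    (hA : ∀ i, 4 * D ≤ (A i).card) (hdisj : Pairwise fun i j => Disjoint (A i) (A j))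
    (S : Finset ι) : ∀ i ∉ S, 2 * D * (partialTransversals A N a S).card ≤
      (partialTransversals A N a (insert i S)).card := by
  induction S using Finset.strongInduction with
  | H S ih =>
  intro i hi
  set T := partialTransversals A N a S with hT
  have hu : ∀ u, 2 * D * (T.filter fun f => ∃ j ∈ S, f j = u).card ≤ T.card := by
    intro u
    by_cases hex : ∃ j ∈ S, u ∈ A j
    · obtain ⟨j, hj, huj⟩ := hex
      have hsub : (T.filter fun f => ∃ j ∈ S, f j = u) ⊆ T.filter fun f => f j = u := by
        intro f hf
        obtain ⟨hf, k, hk, hfk⟩ := mem_filter.1 hf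
        refine mem_filter.2 ⟨hf, ?_⟩
        have huk : u ∈ A k := hfk ▸ (mem_partialTransversals.1 hf).1 k hk
        by_cases hkj : k = j
        · rwa [← hkj]
        · exact absurd huj (disjoint_left.1 (hdisj hkj) huk)
      have h := ih (S.erase j) (erase_ssubset hj) j (notMem_erase j S)
      rw [insert_erase hj] at h
      exact (Nat.mul_le_mul_left _ ((card_le_card hsub).trans (card_filter_apply_eq_le S j u))).trans h
    · have h0 : (T.filter fun f => ∃ j ∈ S, f j = u) = ∅ := by
        refine filter_eq_empty_iff.2 ?_
        rintro f hf ⟨j, hj, rfl⟩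
        exact hex ⟨j, hj, (mem_partialTransversals.1 hf).1 j hj⟩
      simp [h0]
  have hv : ∀ v, T.card ≤ 2 * (T.filter fun f => ∀ j ∈ S, f j ∉ N v).card := by
    intro v
    have hsplit := card_filter_add_card_filter_not (s := T) fun f => ∀ j ∈ S, f j ∉ N v
    have hbad : (T.filter fun f => ¬ ∀ j ∈ S, f j ∉ N v).card ≤
        ∑ u ∈ N v, (T.filter fun f => ∃ j ∈ S, f j = u).card := by
      refine (card_le_card ?_).trans card_biUnion_le
      intro f hf
      obtain ⟨hf, hn⟩ := mem_filter.1 hf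
      push Not at hn
      obtain ⟨j, hj, hjN⟩ := hn
      exact mem_biUnion.2 ⟨f j, hjN, mem_filter.2 ⟨hf, j, hj, rfl⟩⟩
    have hsum : 2 * D * ∑ u ∈ N v, (T.filter fun f => ∃ j ∈ S, f j = u).card ≤ D * T.card := by
      rw [mul_sum]
      refine (sum_le_card_nsmul _ _ _ fun u _ => hu u).trans ?_
      rw [smul_eq_mul]
      exact Nat.mul_le_mul_right _ (hN v)
    have hle : 2 * (T.filter fun f => ¬ ∀ j ∈ S, f j ∉ N v).card ≤ T.card := by
      refine Nat.le_of_mul_le_mul_left ?_ hD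
      calc D * (2 * (T.filter fun f => ¬ ∀ j ∈ S, f j ∉ N v).card)
          = 2 * D * (T.filter fun f => ¬ ∀ j ∈ S, f j ∉ N v).card := by ring
        _ ≤ _ := (Nat.mul_le_mul_left _ hbad).trans hsum
    omega
  have hext := sum_card_extensions_le (A := A) (a := a) hsymm hi
  have hlow : (A i).card * T.card ≤
      ∑ v ∈ A i, 2 * (T.filter fun f => ∀ j ∈ S, f j ∉ N v).card := by
    rw [← smul_eq_mul]
    exact card_nsmul_le_sum _ _ _ fun v _ => hv v
  rw [← mul_sum] at hlow
  have := Nat.mul_le_mul_right T.card (hA i)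
  nlinarith

/-- A family of pairwise disjoint parts of size at least `4 * D` in a graph of maximum degree at
most `D` has an independent transversal. -/
theorem exists_independent_transversal {D : ℕ} (hD : 0 < D)
    (hsymm : ∀ u v, u ∈ N v → v ∈ N u) (hN : ∀ v, (N v).card ≤ D)
    (hA : ∀ i, 4 * D ≤ (A i).card) (hdisj : Pairwise fun i j => Disjoint (A i) (A j)) :
    ∃ f : ι → α, (∀ i, f i ∈ A i) ∧ ∀ i j, i ≠ j → f j ∉ N (f i) := by
  rcases isEmpty_or_nonempty ι with hι | ⟨⟨i₀⟩⟩
  · exact ⟨isEmptyElim, isEmptyElim, isEmptyElim⟩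
  obtain ⟨a, -⟩ : (A i₀).Nonempty := card_pos.1 (by have := hA i₀; omega)
  have hpos : ∀ S : Finset ι, 0 < (partialTransversals A N a S).card := by
    intro S
    induction S using Finset.induction_on with
    | empty => exact card_pos.2 ⟨fun _ => a, mem_partialTransversals.2 (by simp)⟩
    | insert i S hi ih =>
      exact (Nat.mul_pos (by omega) ih).trans_le
        (mul_card_partialTransversals_le hD hsymm hN hA hdisj S i hi)
  obtain ⟨f, hf⟩ := card_pos.1 (hpos univ)
  obtain ⟨h1, -, h3⟩ := mem_partialTransversals.1 hf
  exact ⟨f, fun i => h1 i (mem_univ i), fun i j => h3 i (mem_univ i) j (mem_univ j)⟩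

end Transversal

/-- Walks in a bigraph alternate between the two sides. -/
theorem IsBigraph.two_mul_countP_support_tail {V : Type*} {G : SimpleGraph V} {X Y : Finset V}
    (hBG : IsBigraph G X Y) {u v : V} (p : G.Walk u v) :
    2 * p.support.tail.countP (· ∈ X) + (if u ∈ X then 1 else 0) =
      p.length + (if v ∈ X then 1 else 0) := by
  induction p with
  | nil => simp
  | @cons u w v h p ih =>
    have hXY : ∀ z, z ∈ Y → z ∉ X := fun z hy hx => disjoint_left.1 hBG.1 hx hy
    rw [Walk.support_cons, List.tail_cons, ← Walk.cons_tail_support, List.countP_cons,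
      Walk.length_cons]
    rcases hBG.2.2 h with ⟨hu, hw⟩ | ⟨hu, hw⟩
    · simp only [hu, hXY _ hw, decide_false, Bool.false_eq_true, if_true, if_false] at ih ⊢
      omega
    · simp only [hw, hXY _ hu, decide_true, if_true, if_false] at ih ⊢
      omega

/-- Exactly half of the vertices of a cycle in a bigraph lie in `X`. -/
theorem IsBigraph.two_mul_card_cycle_inter {V : Type*} {G : SimpleGraph V} {X Y : Finset V}
    (hBG : IsBigraph G X Y) {u : V} {c : G.Walk u u} (hc : c.IsCycle) :
    2 * (X.filter fun x => x ∈ c.support).card = c.length := by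
  have h := hBG.two_mul_countP_support_tail c
  have hset : (X.filter fun x => x ∈ c.support) =
      (c.support.tail.filter (· ∈ X)).toFinset := by
    ext x
    simp only [mem_filter, List.mem_toFinset, List.mem_filter, decide_eq_true_eq]
    rw [and_comm, Walk.mem_support_iff]
    refine and_congr_left fun _ => ⟨?_, Or.inr⟩
    rintro (rfl | hx)
    · exact Walk.end_mem_tail_support hc.not_nil
    · exact hx
  rw [hset, List.toFinset_card_of_nodup (hc.support_nodup.filter _), ← List.countP_eq_length_filter]
  omega

/-- The vertices at distance two along a path through some common neighbor number at most `d ^ 2`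
in a graph of maximum degree at most `d`. -/
theorem card_biUnion_neighborFinset_le {V : Type*} [Fintype V] (G : SimpleGraph V)
    [DecidableRel G.Adj] {d : ℕ} (hdeg : ∀ v : V, G.degree v ≤ d) (v : V) :
    ((G.neighborFinset v).biUnion fun y => G.neighborFinset y).card ≤ d ^ 2 := by
  refine card_biUnion_le.trans ((sum_le_card_nsmul _ _ d fun y _ => hdeg y).trans ?_)
  rw [smul_eq_mul, sq]
  exact Nat.mul_le_mul_right _ (hdeg v)

/-- Deleting one edge from each cycle of a cycle cover gives a path cover of the same size. -/
theorem IsCycleXCover.exists_isPathXCover {V : Type*} {G : SimpleGraph V} {X : Finset V}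
    {C : List (Σ u : V, G.Walk u u)} (hC : IsCycleXCover G X C) :
    ∃ P : List (Σ u : V, Σ v : V, G.Walk u v), IsPathXCover G X P ∧ P.length = C.length := by
  obtain ⟨hcyc, hpw, hcov⟩ := hC
  have hsupp : ∀ c ∈ C, ∀ w, w ∈ c.2.tail.support ↔ w ∈ c.2.support := by
    intro c hc w
    have hn := (hcyc c hc).not_nil
    rw [Walk.support_tail_of_not_nil _ hn, Walk.mem_support_iff c.2]
    refine ⟨Or.inr, ?_⟩
    rintro (rfl | h)
    · exact Walk.end_mem_tail_support hn
    · exact h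
  refine ⟨C.map fun c => ⟨c.2.snd, c.1, c.2.tail⟩, ⟨?_, ?_, ?_⟩, List.length_map _⟩
  · simp only [List.mem_map]
    rintro _ ⟨c, hc, rfl⟩
    exact (hcyc c hc).isPath_tail
  · rw [List.pairwise_map]
    refine hpw.imp_of_mem ?_
    intro c e hc he h w
    rw [hsupp c hc, hsupp e he]
    exact h w
  · intro x hx
    obtain ⟨c, hc, hxc⟩ := hcov x hx
    exact ⟨_, List.mem_map_of_mem hc, (hsupp c hc x).2 hxc⟩

theorem lamSet_eq_empty_of_forall {V : Type*} {G : SimpleGraph V} {Y S : Finset V}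
    (h : ∀ u ∈ S, ∀ w ∈ S, u ≠ w → ∀ y, G.Adj y u → ¬ G.Adj y w) : lamSet G Y S = ∅ := by
  refine filter_eq_empty_iff.2 fun y _ hy => ?_
  obtain ⟨u, hu, w, hw, huw⟩ := one_lt_card.1 hy
  obtain ⟨hu, hyu⟩ := mem_filter.1 hu
  obtain ⟨hw, hyw⟩ := mem_filter.1 hw
  exact h u hu w hw huw y hyu hyw

/-- Let `G` be an `(X,Y)`-bigraph with maximum degree at most
`d` and girth at least `4ed² + 1`, and assume there is a collection of pairwise
vertex-disjoint cycles of `G` covering all of `X`. Then `G` has a path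
`X`-cover of size at most `α_Λ(G)`. -/
theorem high_girth_path_cover {V : Type*} [Fintype V] (G : SimpleGraph V)
    [DecidableRel G.Adj] (X Y : Finset V) (hBG : IsBigraph G X Y)
    (d : ℕ) (hd : 1 ≤ d) (hdeg : ∀ v : V, G.degree v ≤ d)
    (hgirth : ∀ (u : V) (c : G.Walk u u), c.IsCycle →
      4 * Real.exp 1 * (d : ℝ) ^ 2 + 1 ≤ (c.length : ℝ))
    (hcyc : ∃ C : List (Σ u : V, G.Walk u u), IsCycleXCover G X C) :
    ∃ P : List (Σ u : V, Σ v : V, G.Walk u v),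
      IsPathXCover G X P ∧ P.length ≤ alphaLam G X Y := by
  obtain ⟨C, hC⟩ := hcyc
  obtain ⟨P, hP, hlen⟩ := hC.exists_isPathXCover
  refine ⟨P, hP, hlen.trans_le ?_⟩
  obtain ⟨hcycle, hpw, -⟩ := hC
  let A : Fin C.length → Finset V := fun i => X.filter fun x => x ∈ (C.get i).2.support
  let N : V → Finset V := fun v => (G.neighborFinset v).biUnion fun y => G.neighborFinset y
  have hsymm : ∀ u v, u ∈ N v → v ∈ N u := by
    intro u v h
    simp only [N, mem_biUnion, mem_neighborFinset] at h ⊢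
    obtain ⟨y, hvy, hyu⟩ := h
    exact ⟨y, hyu.symm, hvy.symm⟩
  have hA : ∀ i, 4 * d ^ 2 ≤ (A i).card := by
    intro i
    have hc := hcycle _ (C.get_mem i)
    have h1 := hgirth _ _ hc
    have h2 : 2 * (A i).card = (C.get i).2.length := hBG.two_mul_card_cycle_inter hc
    rw [← h2] at h1
    push_cast at h1
    have he : (2 : ℝ) ≤ Real.exp 1 := by linarith [Real.exp_one_gt_d9]
    have h3 : (4 * d ^ 2 : ℝ) ≤ (A i).card := by nlinarith [sq_nonneg (d : ℝ)]
    exact_mod_cast h3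
  have hdisj : Pairwise fun i j => Disjoint (A i) (A j) := by
    have key : ∀ i j : Fin C.length, i < j → Disjoint (A i) (A j) := fun i j hij =>
      disjoint_left.2 fun w hi hj =>
        List.pairwise_iff_get.1 hpw i j hij w (mem_filter.1 hi).2 (mem_filter.1 hj).2
    intro i j hij
    rcases lt_or_gt_of_ne hij with h | h
    · exact key i j h
    · exact (key j i h).symm
  obtain ⟨f, hf, hind⟩ := exists_independent_transversal (D := d ^ 2) (by positivity) hsymm
    (card_biUnion_neighborFinset_le G hdeg) hA hdisj
  have hinj : Function.Injective f := by
    intro i j hij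
    by_contra hne
    exact disjoint_left.1 (hdisj hne) (hf i) (hij ▸ hf j)
  have hcard : (univ.image f).card = C.length := by
    rw [card_image_of_injective _ hinj, card_univ, Fintype.card_fin]
  rw [← hcard]
  refine le_sup (f := Finset.card) (mem_filter.2 ⟨mem_powerset.2 ?_, ?_⟩)
  · intro x hx
    obtain ⟨i, -, rfl⟩ := mem_image.1 hx
    exact (mem_filter.1 (hf i)).1
  · refine lamSet_eq_empty_of_forall fun u hu w hw huw y hyu hyw => ?_
    obtain ⟨i, -, rfl⟩ := mem_image.1 hu
    obtain ⟨j, -, rfl⟩ := mem_image.1 hw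
    refine hind i j (fun h => huw (h ▸ rfl)) ?_
    exact mem_biUnion.2 ⟨y, (G.mem_neighborFinset _ _).2 hyu.symm, (G.mem_neighborFinset _ _).2 hyw⟩
end

section
/- Let d ≥ 2 be an integer and let G be a d-regular (X,Y)-bigraph in which every cycle has length at least 4ed² + 1 (girth at least 4ed² + 1). Then G has a path X-cover consisting of at most α_Λ(G) paths. -/
open Finset SimpleGraph
open scoped Classical

variable {V : Type*}

/-- The `R`-independent sets that contain exactly one point of each fibre of `p` over `S`,
and no other points. -/
noncomputable def indepTransversals {α ι : Type*} [Fintype α] (p : α → ι) (R : α → α → Prop)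
    (S : Finset ι) : Finset (Finset α) :=
  univ.filter fun T => T.image p = S ∧ Set.InjOn p (T : Set α) ∧
    (T : Set α).Pairwise fun u v => ¬ R u v

theorem mem_indepTransversals {α ι : Type*} [Fintype α] {p : α → ι} {R : α → α → Prop}
    {S : Finset ι} {T : Finset α} :
    T ∈ indepTransversals p R S ↔ T.image p = S ∧ Set.InjOn p (T : Set α) ∧
      (T : Set α).Pairwise fun u v => ¬ R u v := by
  simp [indepTransversals]

theorem card_filter_mem_indepTransversals_le {α ι : Type*} [Fintype α] (p : α → ι)
    (R : α → α → Prop) (S : Finset ι) (u : α) :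
    #{T ∈ indepTransversals p R S | u ∈ T} ≤ #(indepTransversals p R (S.erase (p u))) := by
  refine card_le_card_of_injOn (fun T => T.erase u) ?_ ?_
  · intro T hT
    simp only [coe_filter, Set.mem_ofPred_eq, mem_indepTransversals] at hT
    obtain ⟨⟨rfl, hinj, hR⟩, hu⟩ := hT
    simp only [mem_coe, mem_indepTransversals]
    refine ⟨?_, hinj.mono (by simp), hR.mono (by simp)⟩
    ext j
    simp only [mem_image, mem_erase]
    constructor
    · rintro ⟨v, ⟨hvu, hv⟩, rfl⟩
      exact ⟨fun h => hvu (hinj hv hu h), v, hv, rfl⟩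
    · rintro ⟨hj, v, hv, rfl⟩
      exact ⟨v, ⟨fun h => hj (h ▸ rfl), hv⟩, rfl⟩
  · intro T hT T' hT' h
    simp only [coe_filter, Set.mem_ofPred_eq] at hT hT'
    rw [← insert_erase hT.2, ← insert_erase hT'.2]
    exact congrArg (insert u) h

theorem sum_card_extensions_le_s4 {α ι : Type*} [Fintype α] (p : α → ι) (R : α → α → Prop)
    (hR : ∀ u v, R u v → R v u) (S : Finset ι) (i : ι) (hi : i ∉ S) :
    ∑ v with p v = i, #{T ∈ indepTransversals p R S | ∀ u ∈ T, ¬ R v u} ≤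
      #(indepTransversals p R (insert i S)) := by
  rw [← card_sigma]
  refine card_le_card_of_injOn (fun x => insert x.1 x.2) ?_ ?_
  · rintro ⟨v, T⟩ h
    simp only [coe_sigma, Set.mem_sigma_iff, mem_coe, mem_filter, mem_univ, true_and,
      mem_indepTransversals] at h
    obtain ⟨rfl, ⟨rfl, hinj, hRT⟩, hv⟩ := h
    simp only [mem_coe, mem_indepTransversals, image_insert, true_and, coe_insert]
    refine ⟨?_, ?_⟩
    · rw [Set.injOn_insert]
      · exact ⟨hinj, by simpa using hi⟩
      · exact fun h => hi (mem_image_of_mem p h)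
    · refine hRT.insert fun u hu _ => ⟨hv u hu, fun h => hv u hu (hR _ _ h)⟩
  · rintro ⟨v, T⟩ h ⟨v', T'⟩ h' heq
    simp only [coe_sigma, Set.mem_sigma_iff, mem_coe, mem_filter, mem_univ, true_and,
      mem_indepTransversals] at h h'
    dsimp only at heq
    have key : ∀ w ∈ T, p w ≠ i := fun w hw hwi =>
      hi (h.2.1.1 ▸ mem_image.2 ⟨w, hw, hwi⟩)
    have key' : ∀ w ∈ T', p w ≠ i := fun w hw hwi =>
      hi (h'.2.1.1 ▸ mem_image.2 ⟨w, hw, hwi⟩)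
    have hvv : v = v' := by
      have : v ∈ insert v' T' := heq ▸ mem_insert_self v T
      exact (mem_insert.1 this).resolve_right fun hv => key' v hv h.1
    subst hvv
    have hT : v ∉ T := fun hv => key v hv h.1
    have hT' : v ∉ T' := fun hv => key' v hv h.1
    have : T = T' := by rw [← erase_insert hT, heq, erase_insert hT']
    rw [this]

/-- The growth estimate behind the counting proof of the independent transversal theorem. -/
theorem card_mul_card_indepTransversals_le {α ι : Type*} [Fintype α] (p : α → ι)
    (R : α → α → Prop) (hR : ∀ u v, R u v → R v u) (Δ : ℕ)
    (hΔ : ∀ v, #{u | R v u} ≤ Δ) (hp : ∀ i, 4 * Δ ≤ #{v | p v = i})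
    (S : Finset ι) (i : ι) (hi : i ∉ S) :
    #{v | p v = i} * #(indepTransversals p R S) ≤
      2 * #(indepTransversals p R (insert i S)) := by
  induction S using Finset.strongInduction generalizing i with
  | H S ih =>
  have hu : ∀ u, 2 * Δ * #{T ∈ indepTransversals p R S | u ∈ T} ≤
      #(indepTransversals p R S) := by
    intro u
    by_cases hpu : p u ∈ S
    · have h1 := ih (S.erase (p u)) (erase_ssubset hpu) (p u) (notMem_erase _ _)
      rw [insert_erase hpu] at h1
      have h2 := card_filter_mem_indepTransversals_le p R S u
      have h3 := Nat.mul_le_mul (hp (p u)) h2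
      nlinarith
    · have : #{T ∈ indepTransversals p R S | u ∈ T} = 0 := by
        rw [card_eq_zero, filter_eq_empty_iff]
        intro T hT huT
        exact hpu ((mem_indepTransversals.1 hT).1 ▸ mem_image_of_mem p huT)
      simp [this]
  have hv : ∀ v, #(indepTransversals p R S) ≤
      2 * #{T ∈ indepTransversals p R S | ∀ u ∈ T, ¬ R v u} := by
    intro v
    have hsplit := card_filter_add_card_filter_not (s := indepTransversals p R S)
      (fun T => ∀ u ∈ T, ¬ R v u)
    have hbad : #{T ∈ indepTransversals p R S | ¬ ∀ u ∈ T, ¬ R v u} ≤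
        ∑ u with R v u, #{T ∈ indepTransversals p R S | u ∈ T} := by
      refine le_trans (card_le_card ?_) card_biUnion_le
      intro T hT
      simp only [mem_filter, not_forall, not_not] at hT
      obtain ⟨hT, u, huT, hvu⟩ := hT
      simp only [mem_biUnion, mem_filter, mem_univ, true_and]
      exact ⟨u, hvu, hT, huT⟩
    rcases Nat.eq_zero_or_pos Δ with h0 | hpos
    · have : ({u | R v u} : Finset α) = ∅ := by
        rw [← card_eq_zero]; have := hΔ v; omega
      rw [this, sum_empty] at hbad
      omega
    · have h1 : 2 * Δ * ∑ u with R v u, #{T ∈ indepTransversals p R S | u ∈ T} ≤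
          Δ * #(indepTransversals p R S) := by
        rw [mul_sum]
        refine (sum_le_card_nsmul _ _ _ fun u _ => hu u).trans ?_
        rw [smul_eq_mul]
        exact Nat.mul_le_mul_right _ (hΔ v)
      have h2 : 2 * ∑ u with R v u, #{T ∈ indepTransversals p R S | u ∈ T} ≤
          #(indepTransversals p R S) := by
        refine Nat.le_of_mul_le_mul_left ?_ hpos
        linarith
      omega
  refine le_trans ?_ (Nat.mul_le_mul_left 2 (sum_card_extensions_le_s4 p R hR S i hi))
  rw [mul_sum, ← smul_eq_mul]
  exact card_nsmul_le_sum _ _ _ fun v _ => hv v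

/-- If a symmetric relation has degrees at most `Δ` and the parts of a partition have at least
`4 * Δ` points each, then there is an independent transversal. -/
theorem exists_indepTransversal {α ι : Type*} [Fintype α] [Fintype ι] (p : α → ι)
    (hsurj : Function.Surjective p)
    (R : α → α → Prop) [DecidableRel R] (hR : ∀ u v, R u v → R v u) (Δ : ℕ)
    (hΔ : ∀ v, #{u | R v u} ≤ Δ) (hp : ∀ i, 4 * Δ ≤ #{v | p v = i}) :
    ∃ T : Finset α, #T = Fintype.card ι ∧ (T : Set α).Pairwise fun u v => ¬ R u v := by
  have hpos : ∀ S : Finset ι, 0 < #(indepTransversals p R S) := by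
    intro S
    induction S using Finset.induction_on with
    | empty => exact card_pos.2 ⟨∅, by simp [mem_indepTransversals]⟩
    | insert i S hi ih =>
      have h := card_mul_card_indepTransversals_le p R hR Δ
        (fun v => by convert hΔ v) hp S i hi
      obtain ⟨v, hv⟩ := hsurj i
      have : 0 < #{v | p v = i} := card_pos.2 ⟨v, by simpa using hv⟩
      have := Nat.mul_pos this ih
      omega
  obtain ⟨T, hT⟩ := card_pos.1 (hpos univ)
  obtain ⟨h1, h2, h3⟩ := mem_indepTransversals.1 hT
  refine ⟨T, ?_, h3⟩
  rw [← card_univ, ← h1, card_image_of_injOn h2]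

/-- A relation in which all left degrees are at least `k` and all right degrees are at most `k`
has a matching covering the left side. -/
theorem exists_injective_of_degree_bounds {α β : Type*} [Fintype α] [Fintype β]
    (r : α → β → Prop) [DecidableRel r] (k : ℕ) (hk : 0 < k) (hα : ∀ a, k ≤ #{b | r a b})
    (hβ : ∀ b, #{a | r a b} ≤ k) :
    ∃ f : α → β, Function.Injective f ∧ ∀ a, r a (f a) := by
  rw [← Fintype.all_card_le_filter_rel_iff_exists_injective]
  intro A
  refine Nat.le_of_mul_le_mul_right (card_mul_le_card_mul r (fun a ha => ?_) fun b _ => ?_) hk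
  · refine (hα a).trans (card_le_card fun b hb => ?_)
    simp only [mem_filter, mem_univ, true_and, mem_bipartiteAbove] at hb ⊢
    exact ⟨⟨a, ha, hb⟩, hb⟩
  · refine (card_le_card fun a ha => ?_).trans (hβ b)
    simp only [mem_filter, mem_univ, true_and, mem_bipartiteBelow] at ha ⊢
    exact ha.2

theorem exists_alternating_walk {A : Type*} (G : SimpleGraph V) (a f : A → V) (σ : A → A)
    (ha : Function.Injective a) (hf : Function.Injective f) (haf : ∀ x y, a x ≠ f y)
    (h1 : ∀ x, G.Adj (a x) (f x)) (h2 : ∀ x, G.Adj (f x) (a (σ x))) (x : A) (n : ℕ) :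
    ∃ w : G.Walk (a x) (f (σ^[n] x)), w.length = 2 * n + 1 ∧
      (∀ z, z ∈ w.support ↔ ∃ i ≤ n, z = a (σ^[i] x) ∨ z = f (σ^[i] x)) ∧
      (Set.InjOn (fun i => σ^[i] x) (Set.Iic n) → w.IsPath) := by
  induction n with
  | zero =>
    refine ⟨Walk.cons (h1 x) Walk.nil, by simp, by simp, fun _ => ?_⟩
    simp [Walk.cons_isPath_iff, haf]
  | succ n ih =>
    obtain ⟨w, hl, hs, hw⟩ := ih
    have e : G.Adj (f (σ^[n] x)) (a (σ^[n + 1] x)) := by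
      rw [Function.iterate_succ_apply']; exact h2 _
    refine ⟨(w.concat e).concat (h1 _), by rw [Walk.length_concat, Walk.length_concat, hl]; ring, fun z => ?_, fun hinj => ?_⟩
    · simp only [Walk.support_concat, List.mem_append, hs, List.mem_singleton]
      grind
    · have hne : ∀ i ≤ n, σ^[n + 1] x ≠ σ^[i] x := fun i hi h => by
        have := hinj (Set.mem_Iic.2 le_rfl) (Set.mem_Iic.2 (hi.trans n.le_succ)) h
        omega
      refine Walk.IsPath.concat (Walk.IsPath.concat
        (hw (hinj.mono (Set.Iic_subset_Iic.2 n.le_succ))) ?_ e) ?_ _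
      · rw [hs]
        rintro ⟨i, hi, h | h⟩
        · exact hne i hi (ha h)
        · exact haf _ _ h
      · simp only [Walk.support_concat, List.mem_append, hs, List.mem_singleton]
        rintro (⟨i, hi, h | h⟩ | h)
        · exact haf _ _ h.symm
        · exact hne i hi (hf h)
        · exact haf _ _ h.symm

/-- An orbit of `σ` yields a path through all its vertices that closes up to a cycle. -/
theorem exists_orbit_path {A : Type*} [Fintype A] (G : SimpleGraph V) (a f : A → V)
    (σ : Equiv.Perm A)
    (ha : Function.Injective a) (hf : Function.Injective f) (haf : ∀ x y, a x ≠ f y)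
    (h1 : ∀ x, G.Adj (a x) (f x)) (h2 : ∀ x, G.Adj (f x) (a (σ x))) (hσ : ∀ x, σ x ≠ x)
    (x : A) :
    (∃ v, ∃ w : G.Walk (a x) v, w.IsPath ∧
      ∀ z, z ∈ w.support ↔ ∃ y, σ.SameCycle x y ∧ (z = a y ∨ z = f y)) ∧
    ∃ v, ∃ c : G.Walk v v, c.IsCycle ∧ c.length ≤ 2 * #{y | σ.SameCycle x y} := by
  obtain ⟨n, hn⟩ : ∃ n, Function.minimalPeriod σ x = n + 1 := by
    have hx : x ∈ Function.periodicPts σ :=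
      σ.injective.mem_periodicPts x
    exact ⟨_, (Nat.succ_pred_eq_of_pos (Function.minimalPeriod_pos_of_mem_periodicPts hx)).symm⟩
  have hinj : Set.InjOn (fun i => σ^[i] x) (Set.Iic n) := by
    have := Function.iterate_injOn_Iio_minimalPeriod (f := σ) (x := x)
    rw [hn] at this
    exact this.mono fun i hi => by simpa [Nat.lt_succ_iff] using hi
  have hcyc : ∀ y, σ.SameCycle x y ↔ ∃ i ≤ n, y = σ^[i] x := by
    intro y
    constructor
    · intro h
      obtain ⟨i, -, rfl⟩ := h.exists_pow_eq'
      refine ⟨i % (n + 1), Nat.lt_succ_iff.1 (Nat.mod_lt _ n.succ_pos), ?_⟩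
      rw [← hn, Function.iterate_mod_minimalPeriod_eq, Equiv.Perm.iterate_eq_pow]
    · rintro ⟨i, -, rfl⟩
      exact ⟨i, by rw [Equiv.Perm.iterate_eq_pow, zpow_natCast]⟩
  obtain ⟨w, hl, hs, hw⟩ := exists_alternating_walk G a f σ ha hf haf h1 h2 x n
  have hw := hw hinj
  refine ⟨⟨_, w, hw, fun z => ?_⟩, ?_⟩
  · rw [hs]
    simp only [hcyc]
    grind
  · have hper : σ (σ^[n] x) = x := by
      have := Function.iterate_minimalPeriod (f := σ) (x := x)
      rwa [hn, Function.iterate_succ_apply'] at this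
    have e : G.Adj (f (σ^[n] x)) (a x) := by
      have := h2 (σ^[n] x)
      rwa [hper] at this
    refine ⟨_, Walk.cons e w, (Walk.cons_isCycle_iff _ _).2 ⟨hw, fun h => ?_⟩, ?_⟩
    · rw [Sym2.eq_swap] at h
      have := hw.length_eq_one_of_mem_edges h
      obtain rfl : n = 0 := by omega
      exact hσ x hper
    · have : n + 1 ≤ #{y | σ.SameCycle x y} := by
        rw [← card_range (n + 1)]
        refine card_le_card_of_injOn (fun i => σ^[i] x) (fun i hi => ?_) (hinj.mono fun i hi => ?_)
        · simp only [coe_range, Set.mem_Iio] at hi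
          simp only [coe_filter, mem_univ, true_and, Set.mem_ofPred_eq, hcyc]
          exact ⟨i, by omega, rfl⟩
        · simp only [coe_range, Set.mem_Iio] at hi
          exact Set.mem_Iic.2 (by omega)
      simp only [Walk.length_cons, hl]
      omega

theorem IsBigraph.symm {G : SimpleGraph V} {X Y : Finset V} (h : IsBigraph G X Y) :
    IsBigraph G Y X :=
  ⟨h.1.symm, fun v => (h.2.1 v).symm, fun _ _ e => (h.2.2 e).symm⟩

theorem IsBigraph.mem_right_of_adj {G : SimpleGraph V} {X Y : Finset V} (h : IsBigraph G X Y)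
    {u v : V} (hu : u ∈ X) (e : G.Adj u v) : v ∈ Y := by
  rcases h.2.2 e with h' | h'
  · exact h'.2
  · exact (disjoint_left.1 h.1 hu h'.1).elim

theorem card_filter_adj_eq_degree [Fintype V] (G : SimpleGraph V) [DecidableRel G.Adj] (v : V) :
    #{u | G.Adj v u} = G.degree v := by
  rw [← G.card_neighborFinset_eq_degree]
  congr 1
  ext u
  simp

theorem card_filter_subtype_adj_le [Fintype V] (G : SimpleGraph V) [DecidableRel G.Adj]
    (X : Finset V) (v : V) :
    #{x : X | G.Adj x v} ≤ G.degree v := by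
  rw [← card_filter_adj_eq_degree]
  refine card_le_card_of_injOn Subtype.val (fun x hx => ?_) Subtype.val_injective.injOn
  simpa [G.adj_comm] using hx

theorem exists_matching [Fintype V] (G : SimpleGraph V) [DecidableRel G.Adj] (X : Finset V)
    (d : ℕ) (hd : 0 < d) (hreg : ∀ v : V, G.degree v = d) :
    ∃ f : X → V, Function.Injective f ∧ ∀ x : X, G.Adj x (f x) :=
  exists_injective_of_degree_bounds (fun (x : X) v => G.Adj x v) d hd
    (fun x => by rw [card_filter_adj_eq_degree, hreg])
    (fun v => (card_filter_subtype_adj_le G X v).trans (hreg v).le)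

theorem IsBigraph.card_le [Fintype V] {G : SimpleGraph V} [DecidableRel G.Adj] {X Y : Finset V}
    (h : IsBigraph G X Y) (d : ℕ) (hd : 0 < d) (hreg : ∀ v : V, G.degree v = d) :
    #X ≤ #Y := by
  obtain ⟨f, hf, hfa⟩ := exists_matching G X d hd hreg
  rw [← card_attach]
  exact card_le_card_of_injOn f (fun x _ => h.mem_right_of_adj x.2 (hfa x)) hf.injOn

theorem IsBigraph.matching_surjOn [Fintype V] {G : SimpleGraph V} [DecidableRel G.Adj]
    {X Y : Finset V} (h : IsBigraph G X Y) (d : ℕ) (hd : 0 < d) (hreg : ∀ v : V, G.degree v = d)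
    (f : X → V) (hf : Function.Injective f) (hfa : ∀ x : X, G.Adj x (f x)) {y : V} (hy : y ∈ Y) :
    ∃ x, f x = y := by
  have himg : univ.image f = Y := by
    refine eq_of_subset_of_card_le (fun v hv => ?_) ?_
    · obtain ⟨x, -, rfl⟩ := mem_image.1 hv
      exact h.mem_right_of_adj x.2 (hfa x)
    · rw [card_image_of_injective _ hf, card_univ, Fintype.card_coe]
      exact h.symm.card_le d hd hreg
  simpa [← himg] using hy

/-- A `d`-regular bigraph with `d ≥ 2` has two disjoint perfect matchings, presented as a
perfect matching `f` and the permutation of `X` obtained by following `f` and then the other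
matching. -/
theorem IsBigraph.exists_matching_perm [Fintype V] {G : SimpleGraph V} [DecidableRel G.Adj]
    {X Y : Finset V} (h : IsBigraph G X Y) (d : ℕ) (hd : 2 ≤ d)
    (hreg : ∀ v : V, G.degree v = d) :
    ∃ (f : X → V) (σ : Equiv.Perm X), Function.Injective f ∧ (∀ x : X, G.Adj x (f x)) ∧
      (∀ x, G.Adj (f x) (σ x)) ∧ ∀ x, σ x ≠ x := by
  have hd0 : 0 < d := by omega
  obtain ⟨f, hf, hfa⟩ := exists_matching G X d hd0 hreg
  obtain ⟨g, hg, hga⟩ := exists_injective_of_degree_bounds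
    (fun (x : X) v => G.Adj x v ∧ v ≠ f x) (d - 1) (by omega)
    (fun x => by
      have : ({v | G.Adj x v ∧ v ≠ f x} : Finset V) = ({v | G.Adj x v} : Finset V).erase (f x) := by
        ext v; simp [and_comm]
      rw [this, card_erase_of_mem (by simpa using hfa x), card_filter_adj_eq_degree, hreg])
    (fun v => by
      by_cases hv : v ∈ Y
      · obtain ⟨x, rfl⟩ := h.matching_surjOn d hd0 hreg f hf hfa hv
        have : #{x' : X | G.Adj x' (f x) ∧ f x ≠ f x'} < #{x' : X | G.Adj x' (f x)} := by
          refine card_lt_card ⟨fun x' hx' => ?_, fun hsub => ?_⟩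
          · simp only [mem_filter] at hx' ⊢
            exact ⟨hx'.1, hx'.2.1⟩
          · have := hsub (mem_filter.2 ⟨mem_univ x, hfa x⟩)
            simp at this
        have h' := card_filter_subtype_adj_le G X (f x)
        rw [hreg] at h'
        omega
      · have : ({x : X | G.Adj x v ∧ v ≠ f x} : Finset X) = ∅ := by
          rw [filter_eq_empty_iff]
          exact fun x _ hx => hv (h.mem_right_of_adj x.2 hx.1)
        rw [this]
        exact Nat.zero_le _)
  have hσ : ∀ x, ∃ x', g x' = f x := fun x =>
    h.matching_surjOn d hd0 hreg g hg (fun x => (hga x).1) (h.mem_right_of_adj x.2 (hfa x))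
  choose s hs using hσ
  have hsinj : Function.Injective s := fun x x' hx => hf (by rw [← hs, ← hs, hx])
  refine ⟨f, Equiv.ofBijective s (Finite.injective_iff_bijective.1 hsinj), hf, hfa, fun x => ?_,
    fun x hx => ?_⟩
  · have := (hga (s x)).1
    rw [hs] at this
    exact this.symm
  · have hx : s x = x := hx
    have := hs x
    rw [hx] at this
    exact (hga x).2 this

theorem card_filter_common_neighbor_le [Fintype V] (G : SimpleGraph V) [DecidableRel G.Adj]
    (X : Finset V) (d : ℕ) (hreg : ∀ v : V, G.degree v = d) (x : X) :
    #{x' : X | ∃ y, G.Adj y x ∧ G.Adj y x'} ≤ d ^ 2 := by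
  have hsub : ({x' : X | ∃ y, G.Adj y x ∧ G.Adj y x'} : Finset X) ⊆
      ({y | G.Adj x y} : Finset V).biUnion fun y => {x' : X | G.Adj x' y} := by
    intro x' hx'
    simp only [mem_filter, mem_univ, true_and, mem_biUnion] at hx' ⊢
    obtain ⟨y, h1, h2⟩ := hx'
    exact ⟨y, h1.symm, h2.symm⟩
  refine (card_le_card hsub).trans ((card_biUnion_le_card_mul _ _ d fun y _ => ?_).trans ?_)
  · exact (card_filter_subtype_adj_le G X y).trans (hreg y).le
  · rw [card_filter_adj_eq_degree, hreg, sq]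

theorem card_le_alphaLam {G : SimpleGraph V} {X Y : Finset V} (T : Finset X)
    (hT : (T : Set X).Pairwise fun u v => ¬ ∃ y, G.Adj y u ∧ G.Adj y v) :
    #T ≤ alphaLam G X Y := by
  rw [← card_map (Function.Embedding.subtype (· ∈ X))]
  refine le_sup (f := Finset.card) ?_
  simp only [mem_filter, mem_powerset, lamSet, filter_eq_empty_iff]
  refine ⟨fun v hv => ?_, fun y _ hy => ?_⟩
  · obtain ⟨x, -, rfl⟩ := mem_map.1 hv
    exact x.2
  · obtain ⟨u, hu, v, hv, huv⟩ := one_lt_card.1 hy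
    simp only [mem_filter, mem_map] at hu hv
    obtain ⟨⟨u, hu, rfl⟩, hyu⟩ := hu
    obtain ⟨⟨v, hv, rfl⟩, hyv⟩ := hv
    exact hT hu hv (fun h => huv (h ▸ rfl)) ⟨y, hyu, hyv⟩

/-- Let `d ≥ 2` and let `G` be a `d`-regular `(X,Y)`-bigraph
with girth at least `4ed² + 1`. Then `G` has a path `X`-cover of size at most
`α_Λ(G)`. -/
theorem regular_high_girth_path_cover {V : Type*} [Fintype V] (G : SimpleGraph V)
    [DecidableRel G.Adj] (X Y : Finset V) (hBG : IsBigraph G X Y)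
    (d : ℕ) (hd : 2 ≤ d) (hreg : ∀ v : V, G.degree v = d)
    (hgirth : ∀ (u : V) (c : G.Walk u u), c.IsCycle →
      4 * Real.exp 1 * (d : ℝ) ^ 2 + 1 ≤ (c.length : ℝ)) :
    ∃ P : List (Σ u : V, Σ v : V, G.Walk u v),
      IsPathXCover G X P ∧ P.length ≤ alphaLam G X Y := by
  obtain ⟨f, σ, hf, h1, h2, hσ⟩ := hBG.exists_matching_perm d hd hreg
  have haf : ∀ x y : X, (x : V) ≠ f y := fun x y h =>
    disjoint_left.1 hBG.1 x.2 (h ▸ hBG.mem_right_of_adj y.2 (h1 y))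
  have horb := exists_orbit_path G Subtype.val f σ Subtype.val_injective hf haf h1 h2 hσ
  let ι := Quotient (Equiv.Perm.SameCycle.setoid σ)
  let p : X → ι := Quotient.mk _
  have hpe : ∀ x y : X, p x = p y ↔ σ.SameCycle x y := fun x y => Quotient.eq
  have hpout : ∀ i : ι, p i.out = i := Quotient.out_eq
  have hsize : ∀ i : ι, 4 * d ^ 2 ≤ #{v | p v = i} := by
    intro i
    obtain ⟨v, c, hc, hlen⟩ := (horb i.out).2
    have heq : ({v | p v = i} : Finset X) =
        ({y | σ.SameCycle i.out y} : Finset X) := by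
      ext y
      simp only [mem_filter, mem_univ, true_and]
      rw [← hpe, hpout, eq_comm]
    have hlen' : c.length ≤ 2 * #{v | p v = i} := by
      rw [heq]
      convert hlen
    generalize #{v | p v = i} = N at hlen' ⊢
    have hg := (hgirth v c hc).trans (Nat.cast_le.2 hlen')
    push_cast at hg
    have : (4 * d ^ 2 : ℝ) ≤ N := by nlinarith [sq_nonneg (d : ℝ), Real.exp_one_gt_d9]
    exact_mod_cast this
  obtain ⟨T, hT, hTR⟩ := exists_indepTransversal p Quotient.mk_surjective
    (fun x x' : X => ∃ y, G.Adj y x ∧ G.Adj y x')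
    (fun _ _ ⟨y, h, h'⟩ => ⟨y, h', h⟩) (d ^ 2)
    (card_filter_common_neighbor_le G X d hreg)
    (fun i => by convert hsize i)
  choose v w hw hs using fun x => (horb x).1
  refine ⟨(univ : Finset ι).toList.map fun i => ⟨_, _, w i.out⟩, ⟨?_, ?_, ?_⟩, ?_⟩
  · intro q hq
    obtain ⟨i, -, rfl⟩ := List.mem_map.1 hq
    exact hw _
  · rw [List.pairwise_map]
    refine (nodup_toList _).imp fun {i j} hij z hz hz' => hij ?_
    obtain ⟨y, hy, hzy⟩ := (hs _ _).1 hz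
    obtain ⟨y', hy', hzy'⟩ := (hs _ _).1 hz'
    have hyy : y = y' := by
      rcases hzy with rfl | rfl <;> rcases hzy' with h | h
      · exact Subtype.val_injective h
      · exact (haf _ _ h).elim
      · exact (haf _ _ h.symm).elim
      · exact hf h
    rw [← hpout i, ← hpout j, (hpe _ _).2 hy, (hpe _ _).2 hy', hyy]
  · intro x hx
    refine ⟨_, List.mem_map.2 ⟨p ⟨x, hx⟩, by simp, rfl⟩, ?_⟩
    exact (hs _ _).2 ⟨⟨x, hx⟩, (hpe _ _).1 (hpout _), Or.inl rfl⟩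
  · rw [List.length_map, length_toList, card_univ, ← hT]
    exact card_le_alphaLam T hTR
end

section
/- Let G be an (X,Y)-bigraph, let S ⊆ X, and let 𝒫 be a set of pairwise vertex-disjoint paths of G such that the union of the vertex sets of the paths in 𝒫 intersects X exactly in S. Then |𝒫| ≥ |S| − |Λ_G(S)|, i.e., |𝒫| ≥ def(G,S). -/
open Finset SimpleGraph
open scoped Classical

variable {V : Type*}

/-- Along a path of a bigraph whose `X`-vertices all lie in `S`, the vertices of `X` outnumber
those of `Λ_G(S)` by at most one. -/
theorem countP_support_le_of_isPath {V : Type*} {G : SimpleGraph V} {X Y S : Finset V}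
    (hBG : IsBigraph G X Y) : ∀ {u v : V} (p : G.Walk u v), p.IsPath →
      (∀ x ∈ X, x ∈ p.support → x ∈ S) →
      p.support.countP (· ∈ X) ≤ p.support.countP (· ∈ lamSet G Y S) + 1
  | _, _, .nil, _, _ => by
    rw [Walk.support_nil, List.countP_singleton]
    split <;> omega
  | u, _, .cons (v := w) h .nil, _, _ => by
    have hX : ¬ (u ∈ X ∧ w ∈ X) := fun ⟨hu, hw⟩ => by
      rcases hBG.2.2 h with ⟨-, hy⟩ | ⟨hy, -⟩
      · exact Finset.disjoint_left.1 hBG.1 hw hy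
      · exact Finset.disjoint_left.1 hBG.1 hu hy
    simp only [Walk.support_cons, Walk.support_nil, List.countP_cons, List.countP_nil,
      decide_eq_true_eq]
    split_ifs <;> first | omega | tauto
  | u, _, .cons (v := w) h (.cons (v := t) h' q), hp, hS => by
    have hp' := (Walk.cons_isPath_iff h _).1 hp
    rcases hBG.2.2 h with ⟨hu, hw⟩ | ⟨hu, -⟩
    · have ht : t ∈ X := by
        rcases hBG.2.2 h' with ⟨hw', -⟩ | ⟨-, ht⟩
        · exact absurd hw (Finset.disjoint_left.1 hBG.1 hw')
        · exact ht
      have hwX : w ∉ X := fun hw' => Finset.disjoint_left.1 hBG.1 hw' hw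
      have hut : u ≠ t := by
        rintro rfl
        exact hp'.2 (by simp)
      have hwΛ : w ∈ lamSet G Y S := by
        refine Finset.mem_filter.2 ⟨hw, Finset.one_lt_card.2 ⟨u, ?_, t, ?_, hut⟩⟩
        · exact Finset.mem_filter.2 ⟨hS u hu (by simp), h.symm⟩
        · exact Finset.mem_filter.2 ⟨hS t ht (by simp), h'⟩
      have ih := countP_support_le_of_isPath hBG q hp'.1.of_cons
        fun x hx hxq => hS x hx (by simp [hxq])
      simp only [Walk.support_cons, List.countP_cons, decide_eq_true_eq, if_pos hu, if_neg hwX,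
        if_pos hwΛ]
      omega
    · have huX : u ∉ X := fun hu' => Finset.disjoint_left.1 hBG.1 hu' hu
      have ih := countP_support_le_of_isPath hBG (.cons h' q) hp'.1
        fun x hx hxq => hS x hx (List.mem_cons_of_mem _ hxq)
      rw [Walk.support_cons, List.countP_cons, List.countP_cons]
      simp only [decide_eq_true_eq, if_neg huX]
      omega

/-- If `f` exceeds `g` by at most one on every entry of a list, then the sums over the list
differ by at most its length. -/
theorem List.sum_map_le_sum_map_add_length {α : Type*} {f g : α → ℕ} :
    ∀ {l : List α}, (∀ a ∈ l, f a ≤ g a + 1) → (l.map f).sum ≤ (l.map g).sum + l.length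
  | [], _ => by simp
  | a :: l, h => by
    have ih := List.sum_map_le_sum_map_add_length fun b hb => h b (List.mem_cons_of_mem a hb)
    have ha := h a List.mem_cons_self
    simp only [List.map_cons, List.sum_cons, List.length_cons]
    omega

/-- If `P` is a set of pairwise vertex-disjoint paths of an
`(X,Y)`-bigraph `G` whose union of vertex sets intersects `X` exactly in `S`,
then `|P| ≥ |S| − |Λ_G(S)| = def(G,S)`. -/
theorem path_cover_lower_bound {V : Type*} (G : SimpleGraph V) (X Y : Finset V)
    (hBG : IsBigraph G X Y) (S : Finset V) (hS : S ⊆ X)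
    (P : List (Σ u : V, Σ v : V, G.Walk u v))
    (hP : IsPathExactCover G X S P) :
    lamDefSet G Y S ≤ (P.length : ℤ) := by
  obtain ⟨hpath, hdisj, hcov⟩ := hP
  set L : List V := P.flatMap fun p => p.2.2.support with hL
  have hnodup : L.Nodup := List.nodup_flatMap.2
    ⟨fun p hp => (hpath p hp).support_nodup, hdisj⟩
  have hSL : S.card ≤ L.countP (· ∈ X) := by
    rw [List.countP_eq_length_filter]
    refine (Finset.card_le_card fun x hx => ?_).trans (List.toFinset_card_le _)
    obtain ⟨p, hp, hxp⟩ := (hcov x (hS hx)).2 hx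
    simpa [hL, hS hx] using ⟨_, _, _, hp, hxp⟩
  have hΛL : L.countP (· ∈ lamSet G Y S) ≤ (lamSet G Y S).card := by
    rw [List.countP_eq_length_filter, ← List.toFinset_card_of_nodup (hnodup.filter _)]
    exact Finset.card_le_card fun x hx => by
      rw [List.mem_toFinset, List.mem_filter, decide_eq_true_eq] at hx
      exact hx.2
  have hle : L.countP (· ∈ X) ≤ L.countP (· ∈ lamSet G Y S) + P.length := by
    rw [hL, List.countP_flatMap, List.countP_flatMap]
    exact List.sum_map_le_sum_map_add_length fun p hp =>
      countP_support_le_of_isPath hBG p.2.2 (hpath p hp) fun x hx hxp => (hcov x hx).1 ⟨p, hp, hxp⟩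
  unfold lamDefSet
  omega
end

section
/- If G is an (X,Y)-bigraph with maximum degree at most 3, then for every subset S ⊆ X there exists a set of at most def(G) pairwise vertex-disjoint paths of G such that the union of the vertex sets of these paths intersects X exactly in S. -/
open Finset SimpleGraph
open scoped Classical

variable {V : Type*}

/-- A list of lists describing pairwise disjoint nonempty paths. -/
def IsPathList (G : SimpleGraph V) (L : List (List V)) : Prop :=
  (∀ l ∈ L, l ≠ [] ∧ l.IsChain G.Adj) ∧ L.flatten.Nodup

/-- `U` is the vertex set of a system of `k` pairwise disjoint paths. -/
def PathSys (G : SimpleGraph V) (k : ℕ) (U : Finset V) : Prop :=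
  ∃ L, IsPathList G L ∧ (∀ x, x ∈ U ↔ x ∈ L.flatten) ∧ L.length = k

/-- A system of `k` disjoint paths on `U`, one of which starts at `a`. -/
def PathSysEnd (G : SimpleGraph V) (k : ℕ) (U : Finset V) (a : V) : Prop :=
  ∃ p L, p.head? = some a ∧ IsPathList G (p :: L) ∧
    (∀ x, x ∈ U ↔ x ∈ (p :: L).flatten) ∧ L.length + 1 = k

/-- A system of `k` disjoint paths on `U` in which `a` and `b` are the two ends of one path
or ends of two different paths. -/
def PathSysEnds (G : SimpleGraph V) (k : ℕ) (U : Finset V) (a b : V) : Prop :=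
  (∃ p L, p.head? = some a ∧ p.getLast? = some b ∧ IsPathList G (p :: L) ∧
    (∀ x, x ∈ U ↔ x ∈ (p :: L).flatten) ∧ L.length + 1 = k) ∨
  (∃ p q L, p.head? = some a ∧ q.head? = some b ∧ IsPathList G (p :: q :: L) ∧
    (∀ x, x ∈ U ↔ x ∈ (p :: q :: L).flatten) ∧ L.length + 2 = k)

/-- `σ` is the list of inner vertices of a walk from `a` to `c`, and has no repetitions. -/
def IsLink (G : SimpleGraph V) (a : V) (σ : List V) (c : V) : Prop :=
  (a :: (σ ++ [c])).IsChain G.Adj ∧ σ.Nodup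

lemma isChain_reverse_adj {G : SimpleGraph V} {l : List V} (h : l.IsChain G.Adj) :
    l.reverse.IsChain G.Adj := by
  rw [List.isChain_reverse]
  exact h.imp fun _ _ h => h.symm

lemma IsLink.symm {G : SimpleGraph V} {a c : V} {σ : List V} (h : IsLink G a σ c) :
    IsLink G c σ.reverse a := by
  refine ⟨?_, by simpa using h.2⟩
  simpa using isChain_reverse_adj h.1

lemma isLink_singleton {G : SimpleGraph V} {a y c : V} (h : G.Adj y a) (h' : G.Adj y c) :
    IsLink G a [y] c :=
  ⟨by simpa using ⟨h.symm, h'⟩, by simp⟩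

lemma isChain_glue {G : SimpleGraph V} {a c : V} {p σ q : List V} (hp : p.IsChain G.Adj)
    (hpa : p.getLast? = some a) (hσ : IsLink G a σ c) (hq : q.IsChain G.Adj)
    (hqc : q.head? = some c) : (p ++ (σ ++ q)).IsChain G.Adj := by
  obtain ⟨hσ, -⟩ := hσ
  have h1 : ([a] ++ (σ ++ [c])).IsChain G.Adj := hσ
  rw [List.isChain_append, List.isChain_append] at h1
  rw [List.isChain_append, List.isChain_append]
  rcases σ with _ | ⟨s, σ⟩
  · simp_all
  · simp_all

lemma isPathList_cons {G : SimpleGraph V} {p : List V} {L : List (List V)} :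
    IsPathList G (p :: L) ↔ p ≠ [] ∧ p.IsChain G.Adj ∧ p.Nodup ∧
      (∀ x ∈ p, x ∉ L.flatten) ∧ IsPathList G L := by
  simp only [IsPathList, List.flatten_cons, List.nodup_append, List.mem_cons, forall_eq_or_imp]
  constructor
  · rintro ⟨⟨⟨h1, h2⟩, h3⟩, h4, h5, h6⟩
    exact ⟨h1, h2, h4, fun x hx hx' => h6 x hx x hx' rfl, h3, h5⟩
  · rintro ⟨h1, h2, h4, h6, h3, h5⟩
    exact ⟨⟨⟨h1, h2⟩, h3⟩, h4, h5, fun x hx y hy h => h6 x hx (h ▸ hy)⟩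

lemma isPathList_append {G : SimpleGraph V} {L L' : List (List V)} :
    IsPathList G (L ++ L') ↔ IsPathList G L ∧ IsPathList G L' ∧
      ∀ x ∈ L.flatten, x ∉ L'.flatten := by
  simp only [IsPathList, List.flatten_append, List.nodup_append, List.mem_append]
  constructor
  · rintro ⟨h1, h2, h3, h4⟩
    exact ⟨⟨fun l hl => h1 l (.inl hl), h2⟩, ⟨fun l hl => h1 l (.inr hl), h3⟩,
      fun x hx hx' => h4 x hx x hx' rfl⟩
  · rintro ⟨⟨h1, h2⟩, ⟨h1', h3⟩, h4⟩
    exact ⟨fun l hl => hl.elim (h1 l) (h1' l), h2, h3, fun x hx y hy h => h4 x hx (h ▸ hy)⟩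

lemma PathSys.empty (G : SimpleGraph V) : PathSys G 0 ∅ := ⟨[], by simp [IsPathList]⟩

lemma PathSysEnd.singleton (G : SimpleGraph V) (u : V) : PathSysEnd G 1 {u} u :=
  ⟨[u], [], by simp [IsPathList]⟩

lemma PathSysEnds.singleton (G : SimpleGraph V) (u : V) : PathSysEnds G 1 {u} u u :=
  .inl ⟨[u], [], by simp [IsPathList]⟩

lemma PathSysEnd.pathSys {G : SimpleGraph V} {k : ℕ} {U : Finset V} {a : V}
    (h : PathSysEnd G k U a) : PathSys G k U := by
  obtain ⟨p, L, -, h2, h3, h4⟩ := h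
  exact ⟨p :: L, h2, h3, h4⟩

lemma PathSysEnds.left {G : SimpleGraph V} {k : ℕ} {U : Finset V} {a b : V}
    (h : PathSysEnds G k U a b) : PathSysEnd G k U a := by
  obtain ⟨p, L, h1, -, h2, h3, h4⟩ | ⟨p, q, L, h1, -, h2, h3, h4⟩ := h
  · exact ⟨p, L, h1, h2, h3, h4⟩
  · exact ⟨p, q :: L, h1, h2, h3, h4⟩

lemma PathSysEnds.symm {G : SimpleGraph V} {k : ℕ} {U : Finset V} {a b : V}
    (h : PathSysEnds G k U a b) : PathSysEnds G k U b a := by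
  obtain ⟨p, L, h1, h1', h2, h3, h4⟩ | ⟨p, q, L, h1, h1', h2, h3, h4⟩ := h
  · refine .inl ⟨p.reverse, L, by simpa, by simpa, ?_, by simpa using h3, h4⟩
    rw [isPathList_cons] at h2 ⊢
    exact ⟨by simpa using h2.1, isChain_reverse_adj h2.2.1, by simpa using h2.2.2.1,
      by simpa using h2.2.2.2⟩
  · refine .inr ⟨q, p, L, h1', h1, ?_, fun x => (h3 x).trans ?_, h4⟩
    · simp only [isPathList_cons, List.flatten_cons, List.mem_append] at h2 ⊢
      grind
    · simp only [List.flatten_cons, List.mem_append]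
      tauto

lemma PathSys.union {G : SimpleGraph V} {k k' m : ℕ} {U U' W : Finset V}
    (h : PathSys G k U) (h' : PathSys G k' U') (hd : ∀ x ∈ U, x ∉ U')
    (hW : ∀ x, x ∈ W ↔ x ∈ U ∨ x ∈ U') (hm : m = k + k') : PathSys G m W := by
  obtain ⟨L, h1, h2, h3⟩ := h
  obtain ⟨L', h1', h2', h3'⟩ := h'
  simp only [h2, h2'] at hd hW
  exact ⟨L ++ L', isPathList_append.2 ⟨h1, h1', hd⟩, by simpa using hW, by simp; omega⟩

lemma PathSysEnd.union {G : SimpleGraph V} {k k' m : ℕ} {U U' W : Finset V} {a : V}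
    (h : PathSysEnd G k U a) (h' : PathSys G k' U') (hd : ∀ x ∈ U, x ∉ U')
    (hW : ∀ x, x ∈ W ↔ x ∈ U ∨ x ∈ U') (hm : m = k + k') : PathSysEnd G m W a := by
  obtain ⟨p, L, h0, h1, h2, h3⟩ := h
  obtain ⟨L', h1', h2', h3'⟩ := h'
  simp only [h2, h2'] at hd hW
  exact ⟨p, L ++ L', h0, by simpa using isPathList_append.2 ⟨h1, h1', hd⟩,
    fun x => (hW x).trans (by simp [or_assoc]), by simp; omega⟩

lemma PathSysEnds.union {G : SimpleGraph V} {k k' m : ℕ} {U U' W : Finset V} {a b : V}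
    (h : PathSysEnds G k U a b) (h' : PathSys G k' U') (hd : ∀ x ∈ U, x ∉ U')
    (hW : ∀ x, x ∈ W ↔ x ∈ U ∨ x ∈ U') (hm : m = k + k') : PathSysEnds G m W a b := by
  obtain ⟨L', h1', h2', h3'⟩ := h'
  obtain ⟨p, L, h0, h0', h1, h2, h3⟩ | ⟨p, q, L, h0, h0', h1, h2, h3⟩ := h
  · simp only [h2, h2'] at hd hW
    exact .inl ⟨p, L ++ L', h0, h0', by simpa using isPathList_append.2 ⟨h1, h1', hd⟩,
      fun x => (hW x).trans (by simp [or_assoc]), by simp; omega⟩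
  · simp only [h2, h2'] at hd hW
    exact .inr ⟨p, q, L ++ L', h0, h0', by simpa using isPathList_append.2 ⟨h1, h1', hd⟩,
      fun x => (hW x).trans (by simp [or_assoc]), by simp; omega⟩

lemma PathSysEnd.pair {G : SimpleGraph V} {k k' m : ℕ} {U U' W : Finset V} {a b : V}
    (h : PathSysEnd G k U a) (h' : PathSysEnd G k' U' b) (hd : ∀ x ∈ U, x ∉ U')
    (hW : ∀ x, x ∈ W ↔ x ∈ U ∨ x ∈ U') (hm : m = k + k') : PathSysEnds G m W a b := by
  obtain ⟨p, L, h0, h1, h2, h3⟩ := h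
  obtain ⟨q, L', h0', h1', h2', h3'⟩ := h'
  simp only [h2, h2'] at hd hW
  refine .inr ⟨p, q, L ++ L', h0, h0', ?_, fun x => (hW x).trans ?_, by simp; omega⟩
  · simp only [isPathList_cons, isPathList_append, List.flatten_cons, List.flatten_append,
      List.mem_append] at *
    grind
  · simp only [List.flatten_cons, List.flatten_append, List.mem_append]
    tauto

/-- Joining the path ending at `a` with the path ending at `c` along a link. -/
lemma PathSysEnds.join {G : SimpleGraph V} {k k' m : ℕ} {U U' W : Finset V} {a b c : V}
    {σ : List V} (h : PathSysEnds G k U a b) (h' : PathSysEnd G k' U' c) (hσ : IsLink G a σ c)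
    (hd : ∀ x ∈ U, x ∉ U') (hσU : ∀ x ∈ σ, x ∉ U ∧ x ∉ U')
    (hW : ∀ x, x ∈ W ↔ x ∈ U ∨ x ∈ U' ∨ x ∈ σ) (hm : m + 1 = k + k') :
    PathSysEnd G m W b := by
  obtain ⟨q, L', h0', h1', h2', h3'⟩ := h'
  obtain ⟨p, L, h0, hb, h1, h2, h3⟩ | ⟨p, r, L, h0, hb, h1, h2, h3⟩ := h
  · simp only [h2, h2'] at hd hσU hW
    refine ⟨p.reverse ++ (σ ++ q), L ++ L', by simp [hb], ?_, fun x => (hW x).trans ?_,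
      by simp; omega⟩
    · have hc := isPathList_cons.1 h1
      have hc' := isPathList_cons.1 h1'
      have := isChain_glue (isChain_reverse_adj hc.2.1) (by simpa using h0) hσ hc'.2.1 h0'
      have hn := hσ.2
      simp only [isPathList_cons, isPathList_append, List.flatten_cons, List.flatten_append,
        List.mem_append, List.nodup_append, List.nodup_reverse, List.mem_reverse] at *
      refine ⟨by simp [hc.1], this, by grind, by grind, by grind⟩
    · simp only [List.flatten_cons, List.flatten_append, List.mem_append, List.mem_reverse]
      tauto
  · simp only [h2, h2'] at hd hσU hW
    refine ⟨r, (p.reverse ++ (σ ++ q)) :: (L ++ L'), hb, ?_, fun x => (hW x).trans ?_,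
      by simp; omega⟩
    · have hc := isPathList_cons.1 h1
      have hc' := isPathList_cons.1 h1'
      have := isChain_glue (isChain_reverse_adj hc.2.1) (by simpa using h0) hσ hc'.2.1 h0'
      have hn := hσ.2
      simp only [isPathList_cons, isPathList_append, List.flatten_cons, List.flatten_append,
        List.mem_append, List.nodup_append, List.nodup_reverse, List.mem_reverse] at *
      refine ⟨by grind, by grind, by grind, by grind, by simp [hc.1], this, by grind, by grind,
        by grind⟩
    · simp only [List.flatten_cons, List.flatten_append, List.mem_append, List.mem_reverse]
      tauto

lemma PathSysEnd.extend {G : SimpleGraph V} {k : ℕ} {U W : Finset V} {a c : V}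
    {σ : List V} (h : PathSysEnd G k U a) (hσ : IsLink G a σ c) (hc : c ∉ U)
    (hσU : ∀ x ∈ σ, x ∉ U ∧ x ≠ c) (hW : ∀ x, x ∈ W ↔ x ∈ U ∨ x = c ∨ x ∈ σ) :
    PathSysEnd G k W c := by
  refine (PathSysEnds.singleton G c).join h hσ.symm (by simpa) ?_ ?_ (Nat.add_comm _ _)
  · simpa [and_comm] using hσU
  · simp only [hW, Finset.mem_singleton, List.mem_reverse]
    tauto

lemma PathSysEnd.extend_tail {G : SimpleGraph V} {k : ℕ} {U W : Finset V} {a : V}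
    {τ : List V} (h : PathSysEnd G k U a) (hτ : (a :: τ).IsChain G.Adj) (hn : τ.Nodup)
    (hτU : ∀ x ∈ τ, x ∉ U) (hW : ∀ x, x ∈ W ↔ x ∈ U ∨ x ∈ τ) : PathSys G k W := by
  rcases List.eq_nil_or_concat τ with rfl | ⟨σ, c, rfl⟩
  · have : W = U := by ext x; simp [hW]
    exact this ▸ h.pathSys
  · simp only [List.concat_eq_append, List.nodup_append, List.mem_append, List.mem_singleton] at *
    exact (h.extend ⟨hτ, hn.1⟩ (hτU c (.inr rfl)) (fun x hx => ⟨hτU x (.inl hx),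
      hn.2.2 x hx c rfl⟩) (fun x => (hW x).trans (by tauto))).pathSys

lemma PathSysEnds.extend {G : SimpleGraph V} {k : ℕ} {U W : Finset V} {a b c : V}
    {σ : List V} (h : PathSysEnds G k U a b) (hσ : IsLink G a σ c) (hc : c ∉ U)
    (hσU : ∀ x ∈ σ, x ∉ U ∧ x ≠ c) (hW : ∀ x, x ∈ W ↔ x ∈ U ∨ x = c ∨ x ∈ σ) :
    PathSysEnds G k W c b := by
  have hl := hσ.symm
  have hn := hσ.2
  obtain ⟨p, L, h0, hb, h1, h2, h3⟩ | ⟨p, r, L, h0, hb, h1, h2, h3⟩ := h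
  · have hp := isPathList_cons.1 h1
    have := isChain_glue (p := [c]) (by simp) rfl hl hp.2.1 h0
    simp only [h2] at hc hσU hW
    refine .inl ⟨[c] ++ (σ.reverse ++ p), L, rfl,
      by rw [List.getLast?_append, List.getLast?_append, hb]; rfl, ?_,
      fun x => (hW x).trans ?_, h3⟩
    · simp only [isPathList_cons, List.flatten_cons, List.nodup_singleton,
        List.mem_singleton, List.mem_append, List.nodup_append, List.nodup_reverse,
        List.mem_reverse] at *
      refine ⟨by simp, this, by grind, by grind, by grind⟩
    · simp only [List.flatten_cons, List.mem_append, List.mem_reverse, List.mem_singleton]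
      tauto
  · have hp := isPathList_cons.1 h1
    have := isChain_glue (p := [c]) (by simp) rfl hl hp.2.1 h0
    simp only [h2] at hc hσU hW
    refine .inr ⟨[c] ++ (σ.reverse ++ p), r, L, rfl, hb, ?_, fun x => (hW x).trans ?_, h3⟩
    · simp only [isPathList_cons, List.flatten_cons, List.nodup_singleton,
        List.mem_singleton, List.mem_append, List.nodup_append, List.nodup_reverse,
        List.mem_reverse] at *
      refine ⟨by simp, this, by grind, by grind, by grind⟩
    · simp only [List.flatten_cons, List.mem_append, List.mem_reverse, List.mem_singleton]
      tauto

lemma PathSysEnd.congr {G : SimpleGraph V} {k : ℕ} {U W : Finset V} {a : V}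
    (h : PathSysEnd G k U a) (hW : ∀ x, x ∈ W ↔ x ∈ U) : PathSysEnd G k W a := by
  have : W = U := by ext x; exact hW x
  exact this ▸ h

lemma IsLink.cons {G : SimpleGraph V} {u y c : V} {σ : List V} (h : IsLink G y σ c)
    (huy : G.Adj y u) (hy : y ∉ σ) : IsLink G u (y :: σ) c :=
  ⟨List.isChain_cons_cons.2 ⟨huy.symm, h.1⟩, List.nodup_cons.2 ⟨hy, h.2⟩⟩

/-- A rooted configuration: `A` is a set with root `u`, `C` is a set of connecting vertices, and
`A ∪ C` admits many path systems with prescribed ends. -/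
structure Tower (G : SimpleGraph V) (A C : Finset V) (u : V) (n : ℕ) : Prop where
  root_mem : u ∈ A
  disj : ∀ x ∈ A, x ∉ C
  card_eq : A.card = C.card + n + 1
  sys_erase : PathSys G n (A.erase u ∪ C)
  sys_erase_end : ∀ t ∈ A, t ≠ u → PathSysEnd G n (A.erase u ∪ C) t
  sys_ends : ∀ v ∈ A, v ≠ u → PathSysEnds G (n + 1) (A ∪ C) u v
  sys_link : ∀ t ∈ A, t ≠ u → ∀ v ∈ A, v ≠ u → ∀ σ, IsLink G u σ t →
    (∀ x ∈ σ, x ∉ A ∧ x ∉ C) → PathSysEnd G n (A ∪ C ∪ σ.toFinset) v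

/-- A configuration `W`, `C` that may be attached to a root through the connecting
vertex `y ∈ C`. -/
structure PreTower (G : SimpleGraph V) (W C : Finset V) (y : V) (q : ℕ) : Prop where
  nonempty : W.Nonempty
  disj : ∀ x ∈ W, x ∉ C
  card_eq : W.card = C.card + q
  sys_end : ∀ v ∈ W, PathSysEnd G q (W ∪ C) v
  sys_insert : ∀ v ∈ W, ∀ u, u ∉ W → u ∉ C → G.Adj y u →
    PathSysEnds G (q + 1) (insert u (W ∪ C)) u v
  sys_link : ∀ t ∈ W, ∀ v ∈ W, ∀ τ, IsLink G y τ t → (∀ x ∈ τ, x ∉ W ∧ x ∉ C) →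
    PathSysEnd G q (W ∪ C ∪ τ.toFinset) v

lemma Tower.singleton (G : SimpleGraph V) (u : V) : Tower G {u} ∅ u 0 where
  root_mem := by simp
  disj := by simp
  card_eq := by simp
  sys_erase := by simpa using PathSys.empty G
  sys_erase_end := by simp
  sys_ends := by simp
  sys_link := by simp

lemma Tower.sys_ends_root {G : SimpleGraph V} {A C : Finset V} {u : V} {n : ℕ}
    (h : Tower G A C u n) {v : V} (hv : v ∈ A) : PathSysEnds G (n + 1) (A ∪ C) u v := by
  by_cases hvu : v = u
  · subst hvu
    have := h.disj
    refine (PathSysEnds.singleton G v).union h.sys_erase ?_ ?_ (Nat.add_comm _ _) <;>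
    · simp only [mem_union, mem_erase, mem_singleton]
      grind
  · exact h.sys_ends v hv hvu

lemma Tower.sys_end {G : SimpleGraph V} {A C : Finset V} {u : V} {n : ℕ}
    (h : Tower G A C u n) {v : V} (hv : v ∈ A) : PathSysEnd G (n + 1) (A ∪ C) v :=
  (h.sys_ends_root hv).symm.left

lemma Tower.sys_link_end {G : SimpleGraph V} {A C : Finset V} {u : V} {n : ℕ}
    (h : Tower G A C u n) {t v : V} (ht : t ∈ A) (htu : t ≠ u) (hv : v ∈ A) {σ : List V}
    (hσ : IsLink G u σ t) (hσd : ∀ x ∈ σ, x ∉ A ∧ x ∉ C) :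
    PathSysEnd G n (A ∪ C ∪ σ.toFinset) v := by
  by_cases hvu : v = u
  · subst hvu
    have := h.disj
    refine (h.sys_erase_end t ht htu).extend hσ.symm ?_ ?_ ?_ <;>
    · simp only [mem_union, mem_erase, List.mem_toFinset, List.mem_reverse]
      grind
  · exact h.sys_link t ht htu v hv hvu σ hσ hσd

lemma Tower.preTower {G : SimpleGraph V} {A C : Finset V} {u : V} {n : ℕ}
    (h : Tower G A C u n) {y t : V} (hyA : y ∉ A) (hyC : y ∉ C) (ht : t ∈ A) (htu : t ≠ u)
    (hyu : G.Adj y u) (hyt : G.Adj y t) : PreTower G A (insert y C) y n := by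
  have hdisj := h.disj
  have hlink : ∀ t ∈ A, ∀ v ∈ A, ∀ τ, IsLink G y τ t → (∀ x ∈ τ, x ∉ A ∧ x ∉ insert y C) →
      PathSysEnd G n (A ∪ insert y C ∪ τ.toFinset) v := by
    intro s hs v hv τ hτ hd
    have hyτ : y ∉ τ := fun hy => (hd y hy).2 (mem_insert_self _ _)
    by_cases hsu : s = u
    · subst hsu
      refine (h.sys_link_end ht htu hv (hτ.cons hyt hyτ).symm ?_).congr ?_ <;>
      · simp only [mem_union, mem_insert, List.mem_toFinset, List.mem_reverse, List.mem_cons]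
        grind
    · refine (h.sys_link_end hs hsu hv (hτ.cons hyu hyτ) ?_).congr ?_ <;>
      · simp only [mem_union, mem_insert, List.mem_toFinset, List.mem_cons]
        grind
  refine ⟨⟨u, h.root_mem⟩, ?_, ?_, ?_, ?_, hlink⟩
  · grind
  · rw [card_insert_of_notMem hyC, h.card_eq]; omega
  · intro v hv
    simpa using hlink t ht v hv [] ⟨by simpa using hyt, by simp⟩ (by simp)
  · intro v hv w hwA hwC hyw
    have hwy := hyw.ne
    refine (h.sys_ends_root hv).extend (isLink_singleton hyu hyw) ?_ ?_ ?_ <;>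
    · simp only [mem_union, mem_insert, List.mem_singleton]
      grind

lemma Tower.sys_link_pair {G : SimpleGraph V} {A C A' C' : Finset V} {u u' : V} {n n' : ℕ}
    (h : Tower G A C u n) (h' : Tower G A' C' u' n')
    (hd : ∀ x, x ∈ A ∨ x ∈ C → x ∉ A' ∧ x ∉ C') {y : V} (hy : y ∉ A ∧ y ∉ C)
    (hy' : y ∉ A' ∧ y ∉ C') (hyu : G.Adj y u) (hyu' : G.Adj y u') {t v : V}
    (ht : t ∈ A ∪ A') (hv : v ∈ A) {τ : List V} (hτ : IsLink G y τ t)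
    (hτd : ∀ x ∈ τ, x ∉ A ∪ A' ∧ x ∉ insert y (C ∪ C')) :
    PathSysEnd G (n + n' + 1) (A ∪ A' ∪ insert y (C ∪ C') ∪ τ.toFinset) v := by
  have hdisj := h.disj
  have hdisj' := h'.disj
  simp only [mem_union, mem_insert] at ht hτd
  have hyτ : y ∉ τ := fun hy => (hτd y hy).2 (.inl rfl)
  by_cases htA : t ∈ A
  · by_cases htu : t = u
    · subst htu
      refine (h.sys_ends_root hv).join (h'.sys_end h'.root_mem) (hτ.cons hyu' hyτ).symm
        ?_ ?_ ?_ (by omega) <;>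
      · simp only [mem_union, mem_insert, List.mem_toFinset, List.mem_cons, List.mem_reverse]
        grind
    · refine (h.sys_link_end htA htu hv (hτ.cons hyu hyτ) ?_).union
        (h'.sys_end h'.root_mem).pathSys ?_ ?_ (by omega) <;>
      · simp only [mem_union, mem_insert, List.mem_toFinset, List.mem_cons]
        grind
  · refine (h.sys_ends_root hv).join (h'.sys_end (ht.resolve_left htA)) (hτ.cons hyu hyτ)
      ?_ ?_ ?_ (by omega) <;>
    · simp only [mem_union, mem_insert, List.mem_toFinset, List.mem_cons]
      grind

lemma Tower.sys_insert_pair {G : SimpleGraph V} {A C A' C' : Finset V} {u u' : V} {n n' : ℕ}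
    (h : Tower G A C u n) (h' : Tower G A' C' u' n')
    (hd : ∀ x, x ∈ A ∨ x ∈ C → x ∉ A' ∧ x ∉ C') {y : V} (hy : y ∉ A ∧ y ∉ C)
    (hy' : y ∉ A' ∧ y ∉ C') (hyu' : G.Adj y u') {v w : V} (hv : v ∈ A)
    (hw : w ∉ A ∪ A') (hwC : w ∉ insert y (C ∪ C')) (hyw : G.Adj y w) :
    PathSysEnds G (n + n' + 1 + 1) (insert w (A ∪ A' ∪ insert y (C ∪ C'))) w v := by
  have hdisj := h.disj
  have hdisj' := h'.disj
  simp only [mem_union, mem_insert] at hw hwC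
  have : PathSysEnd G (n' + 1) (insert w (insert y (A' ∪ C'))) w := by
    refine (h'.sys_end h'.root_mem).extend (isLink_singleton hyu' hyw) ?_ ?_ ?_ <;>
    · simp only [mem_union, mem_insert, List.mem_singleton]
      grind
  refine this.pair (h.sys_end hv) ?_ ?_ (by omega) <;>
  · simp only [mem_union, mem_insert]
    grind

lemma Tower.preTower_pair {G : SimpleGraph V} {A C A' C' : Finset V} {u u' : V} {n n' : ℕ}
    (h : Tower G A C u n) (h' : Tower G A' C' u' n')
    (hd : ∀ x, x ∈ A ∨ x ∈ C → x ∉ A' ∧ x ∉ C') {y : V} (hy : y ∉ A ∧ y ∉ C)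
    (hy' : y ∉ A' ∧ y ∉ C') (hyu : G.Adj y u) (hyu' : G.Adj y u') :
    PreTower G (A ∪ A') (insert y (C ∪ C')) y (n + n' + 1) := by
  have hdisj := h.disj
  have hdisj' := h'.disj
  have hd' : ∀ x, x ∈ A' ∨ x ∈ C' → x ∉ A ∧ x ∉ C := by grind
  have hlink : ∀ t ∈ A ∪ A', ∀ v ∈ A ∪ A', ∀ τ, IsLink G y τ t →
      (∀ x ∈ τ, x ∉ A ∪ A' ∧ x ∉ insert y (C ∪ C')) →
      PathSysEnd G (n + n' + 1) (A ∪ A' ∪ insert y (C ∪ C') ∪ τ.toFinset) v := by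
    intro t ht v hv τ hτ hτd
    rcases mem_union.1 hv with hv | hv
    · exact h.sys_link_pair h' hd hy hy' hyu hyu' ht hv hτ hτd
    · rw [union_comm A, union_comm C, Nat.add_comm n]
      rw [union_comm A] at ht
      rw [union_comm A, union_comm C] at hτd
      exact h'.sys_link_pair h hd' hy' hy hyu' hyu ht hv hτ hτd
  refine ⟨⟨u, mem_union_left _ h.root_mem⟩, ?_, ?_, ?_, ?_, hlink⟩
  · simp only [mem_union, mem_insert]
    grind
  · rw [card_insert_of_notMem (by simp [hy.2, hy'.2]), card_union_of_disjoint,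
      card_union_of_disjoint, h.card_eq, h'.card_eq]
    · omega
    · exact disjoint_left.2 fun x hx => (hd x (.inr hx)).2
    · exact disjoint_left.2 fun x hx => (hd x (.inl hx)).1
  · intro v hv
    simpa using hlink u (mem_union_left _ h.root_mem) v hv []
      ⟨by simpa using hyu, by simp⟩ (by simp)
  · intro v hv w hwA hwC hyw
    rcases mem_union.1 hv with hv | hv
    · exact h.sys_insert_pair h' hd hy hy' hyu' hv hwA hwC hyw
    · rw [union_comm A, union_comm C, Nat.add_comm n]
      rw [union_comm A] at hwA
      rw [union_comm C] at hwC
      exact h'.sys_insert_pair h hd' hy' hy hyu hv hwA hwC hyw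

lemma Tower.attach {G : SimpleGraph V} {A C W C' : Finset V} {u y : V} {n q : ℕ}
    (h : Tower G A C u n) (h' : PreTower G W C' y q)
    (hd : ∀ x, x ∈ A ∨ x ∈ C → x ∉ W ∧ x ∉ C') (hyu : G.Adj y u) :
    Tower G (A ∪ W) (C ∪ C') u (n + q) := by
  have hdisj := h.disj
  have hdisj' := h'.disj
  have hu := h.root_mem
  obtain ⟨w, hw⟩ := h'.nonempty
  have hW := (h'.sys_end w hw).pathSys
  refine ⟨mem_union_left _ h.root_mem, ?_, ?_, ?_, ?_, ?_, ?_⟩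
  · simp only [mem_union]
    grind
  · rw [card_union_of_disjoint, card_union_of_disjoint, h.card_eq, h'.card_eq]
    · omega
    · exact disjoint_left.2 fun x hx => (hd x (.inr hx)).2
    · exact disjoint_left.2 fun x hx => (hd x (.inl hx)).1
  · refine h.sys_erase.union hW ?_ ?_ rfl <;>
    · simp only [mem_union, mem_erase]
      grind
  · intro t ht htu
    rcases mem_union.1 ht with ht | ht
    · refine (h.sys_erase_end t ht htu).union hW ?_ ?_ rfl <;>
      · simp only [mem_union, mem_erase]
        grind
    · refine (h'.sys_end t ht).union h.sys_erase ?_ ?_ (Nat.add_comm _ _) <;>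
      · simp only [mem_union, mem_erase]
        grind
  · intro v hv hvu
    rcases mem_union.1 hv with hv | hv
    · refine (h.sys_ends v hv hvu).union hW ?_ ?_ (by omega) <;>
      · simp only [mem_union]
        grind
    · refine (h'.sys_insert v hv u (hd u (.inl hu)).1 (hd u (.inl hu)).2 hyu).union
        h.sys_erase ?_ ?_ (by omega) <;>
      · simp only [mem_union, mem_erase, mem_insert]
        grind
  · intro t ht htu v hv hvu σ hσ hσd
    simp only [mem_union] at hσd
    rcases mem_union.1 ht with ht | ht <;> rcases mem_union.1 hv with hv | hv
    · refine (h.sys_link t ht htu v hv hvu σ hσ (by grind)).union hW ?_ ?_ rfl <;>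
      · simp only [mem_union, List.mem_toFinset]
        grind
    · refine (h'.sys_insert v hv u (hd u (.inl hu)).1 (hd u (.inl hu)).2 hyu).join
        (h.sys_erase_end t ht htu) hσ ?_ (by grind) ?_ (by omega) <;>
      · simp only [mem_union, mem_erase, mem_insert, List.mem_toFinset]
        grind
    · refine (h.sys_ends v hv hvu).join (h'.sys_end t ht) hσ ?_ ?_ ?_ (by omega) <;>
      · simp only [mem_union, List.mem_toFinset]
        grind
    · refine (h'.sys_link t ht v hv (u :: σ) (hσ.cons hyu.symm (by grind)) ?_).union h.sys_erase
        ?_ ?_ (Nat.add_comm _ _) <;>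
      · simp only [mem_union, mem_erase, List.mem_toFinset, List.mem_cons]
        grind

/-- `y` has two distinct neighbors in `S`. -/
def HasTwoNbrs (G : SimpleGraph V) (S : Finset V) (y : V) : Prop :=
  ∃ a ∈ S, ∃ b ∈ S, a ≠ b ∧ G.Adj y a ∧ G.Adj y b

lemma HasTwoNbrs.mono {G : SimpleGraph V} {S S' : Finset V} {y : V} (h : HasTwoNbrs G S y)
    (hS : S ⊆ S') : HasTwoNbrs G S' y := by
  obtain ⟨a, ha, b, hb, h⟩ := h
  exact ⟨a, hS ha, b, hS hb, h⟩

lemma mem_lamSet {G : SimpleGraph V} {Y S : Finset V} {y : V} :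
    y ∈ lamSet G Y S ↔ y ∈ Y ∧ HasTwoNbrs G S y := by
  simp only [lamSet, HasTwoNbrs, mem_filter, Finset.one_lt_card]
  grind

/-- `S` and `Y` are disjoint and vertices of `Y` have at most three neighbors. -/
structure IsSubcubicPair (G : SimpleGraph V) (S Y : Finset V) : Prop where
  disj : ∀ x ∈ S, x ∉ Y
  not_four : ∀ y ∈ Y, ∀ a b c d, G.Adj y a → G.Adj y b → G.Adj y c → G.Adj y d →
    a ≠ b → a ≠ c → a ≠ d → b ≠ c → b ≠ d → c ≠ d → False

/-- A nonempty part `B` of `S` can be covered and split off. -/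
def Reducible (G : SimpleGraph V) (S Y : Finset V) : Prop :=
  ∃ B B' C : Finset V, ∃ k : ℕ, B ⊆ S ∧ B.Nonempty ∧ B' ⊆ B ∧ C ⊆ Y ∧ PathSys G k (B ∪ C) ∧
    (∀ y ∈ C, HasTwoNbrs G B y) ∧ k + (lamSet G Y B').card ≤ B'.card ∧
    ∀ y ∈ Y, y ∉ lamSet G Y B' → (∃ b ∈ B', G.Adj y b) → ∀ b ∈ S, G.Adj y b → b ∈ B

/-- A path starting at `u` all of whose vertices in `Y` have two neighbors in `S` on the path. -/
structure IsStack (G : SimpleGraph V) (S Y : Finset V) (u : V) (T : List V) : Prop where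
  chain : (u :: T).IsChain G.Adj
  nodup : (u :: T).Nodup
  head_mem : u ∈ S
  mem : ∀ x ∈ T, x ∈ S ∨ x ∈ Y
  two : ∀ y ∈ T, y ∈ Y → ∃ a b, (a = u ∨ a ∈ T) ∧ (b = u ∨ b ∈ T) ∧ a ∈ S ∧ b ∈ S ∧ a ≠ b ∧
    G.Adj y a ∧ G.Adj y b

lemma IsStack.cons_cons {G : SimpleGraph V} {S Y : Finset V} (hG : IsSubcubicPair G S Y)
    {u : V} {T : List V} (h : IsStack G S Y u T) {y u' : V} (hyY : y ∈ Y) (hyT : y ∉ T)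
    (hyu : G.Adj y u)
    (hyu' : G.Adj y u') (hu' : u' ∈ S) (huu' : u' ≠ u) (hu'T : u' ∉ T) :
    IsStack G S Y u' (y :: u :: T) where
  chain := List.isChain_cons_cons.2 ⟨hyu'.symm, List.isChain_cons_cons.2 ⟨hyu, h.chain⟩⟩
  nodup := by
    have := h.nodup
    have := hyu.ne
    have := hyu'.ne
    simp only [List.nodup_cons, List.mem_cons] at *
    grind
  head_mem := hu'
  mem := by
    intro x hx
    rcases List.mem_cons.1 hx with rfl | hx
    · exact .inr hyY
    · rcases List.mem_cons.1 hx with rfl | hx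
      · exact .inl h.head_mem
      · exact h.mem x hx
  two := by
    intro z hz hzY
    by_cases hzy : z = y
    · subst hzy
      exact ⟨u', u, by simp, by simp, hu', h.head_mem, huu', hyu', hyu⟩
    by_cases hzT : z ∈ T
    · obtain ⟨a, b, ha, hb, h⟩ := h.two z hzT hzY
      exact ⟨a, b, by simp only [List.mem_cons]; tauto, by simp only [List.mem_cons]; tauto, h⟩
    · obtain rfl : z = u := by simpa [hzy, hzT] using hz
      exact (hG.disj z h.head_mem hzY).elim

/-- A set `W` whose path system can be prolonged along a stack yields a reduction. -/
lemma IsStack.reducible {G : SimpleGraph V} {S Y : Finset V} (hG : IsSubcubicPair G S Y)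
    {u : V} {T : List V} (h : IsStack G S Y u T) {W C : Finset V} {q : ℕ} {v y : V}
    (hWS : W ⊆ S) (hCY : C ⊆ Y) (hv : v ∈ W) (hsys : PathSysEnd G q (W ∪ C) v)
    (hcard : W.card = C.card + q) (hyY : y ∈ Y) (hyT : y ∉ T) (hyC : y ∉ C)
    (hyv : G.Adj y v) (hyu : G.Adj y u) (hWT : ∀ x ∈ W, x ≠ u ∧ x ∉ T) (hCT : ∀ x ∈ C, x ∉ T)
    (htwo : ∀ z ∈ C, HasTwoNbrs G W z)
    (hlam : ∀ z ∈ Y, z ∉ T → HasTwoNbrs G W z → z ∈ C)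
    (hclosed : ∀ z ∈ Y, z ∉ T → z ∉ C → (∃ w ∈ W, G.Adj z w) → ∀ b ∈ S, G.Adj z b →
      b ∈ W ∨ b = u ∨ b ∈ T) : Reducible G S Y := by
  have hu := h.head_mem
  have hlam' : ∀ z ∈ Y, HasTwoNbrs G W z → z ∈ C := by
    intro z hz hzW
    by_cases hzT : z ∈ T
    · obtain ⟨a, b, ha, hb, -, -, hab, hza, hzb⟩ := h.two z hzT hz
      obtain ⟨c, hc, d, hd, hcd, hzc, hzd⟩ := hzW
      have := hWT c hc
      have := hWT d hd
      exact (hG.not_four z hz a b c d hza hzb hzc hzd hab (by grind) (by grind) (by grind)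
        (by grind) hcd).elim
    · exact hlam z hz hzT hzW
  have hclosed' : ∀ z ∈ Y, z ∉ C → (∃ w ∈ W, G.Adj z w) → ∀ b ∈ S, G.Adj z b →
      b ∈ W ∨ b = u ∨ b ∈ T := by
    intro z hz hzC hzW c hc hzc
    by_cases hzT : z ∈ T
    · obtain ⟨a, b, ha, hb, -, -, hab, hza, hzb⟩ := h.two z hzT hz
      obtain ⟨d, hd, hzd⟩ := hzW
      have := hWT d hd
      by_contra hcon
      exact hG.not_four z hz a b c d hza hzb hzc hzd hab (by grind) (by grind) (by grind)
        (by grind) (by grind)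
    · exact hclosed z hz hzT hzC hzW c hc hzc
  have hle : (lamSet G Y W).card ≤ C.card :=
    card_le_card fun z hz => hlam' z (mem_lamSet.1 hz).1 (mem_lamSet.1 hz).2
  refine ⟨W ∪ (u :: T).toFinset.filter (· ∈ S), W,
    insert y (C ∪ T.toFinset.filter (· ∈ Y)), q, ?_, ⟨v, by simp [hv]⟩, by simp, ?_, ?_, ?_,
    by omega, ?_⟩
  · grind
  · grind
  · have hmem := h.mem
    have hn := h.nodup
    have hd := hG.disj
    have hyu' := hyu.ne
    refine hsys.extend_tail (τ := y :: u :: T)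
      (List.isChain_cons_cons.2 ⟨hyv.symm, List.isChain_cons_cons.2 ⟨hyu, h.chain⟩⟩) ?_ ?_ ?_
    · simp only [List.nodup_cons, List.mem_cons] at hn ⊢
      grind
    · simp only [List.mem_cons, mem_union]
      grind
    · simp only [List.mem_cons, mem_union, mem_insert, mem_filter, List.mem_toFinset]
      grind
  · intro z hz
    simp only [mem_insert, mem_union, mem_filter, List.mem_toFinset] at hz
    by_cases hzy : z = y
    · subst hzy
      exact ⟨v, by simp [hv], u, by simp [hu], (hWT v hv).1, hyv, hyu⟩
    by_cases hzC : z ∈ C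
    · exact (htwo z hzC).mono subset_union_left
    · obtain ⟨a, b, ha, hb, haS, hbS, hab⟩ := h.two z (by grind) (by grind)
      exact ⟨a, by simp; tauto, b, by simp; tauto, hab⟩
  · intro z hz hzlam hzW b hb hzb
    by_cases hzC : z ∈ C
    · exact (hzlam (mem_lamSet.2 ⟨hz, htwo z hzC⟩)).elim
    · have := hclosed' z hz hzC hzW b hb hzb
      simp only [mem_union, mem_filter, List.mem_toFinset, List.mem_cons]
      tauto

/-- A tower with root `u` grown over the stack `u :: T`, avoiding `Z`, for which the vertices
of `F` have already been examined at the root. -/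
structure Explored (G : SimpleGraph V) (S Y : Finset V) (u : V) (T : List V)
    (Z F A C : Finset V) (n : ℕ) : Prop where
  tower : Tower G A C u n
  subset_left : A ⊆ S
  subset_right : C ⊆ Y
  avoid_left : ∀ x ∈ A, x ∉ T ∧ x ∉ Z
  avoid_right : ∀ x ∈ C, x ∉ T
  closed : ∀ y ∈ Y, y ∉ T → ((∃ a ∈ A, a ≠ u ∧ G.Adj y a) ∨ (y ∈ F ∧ G.Adj y u)) →
    ∀ b ∈ S, G.Adj y b → b ∈ A ∨ b ∈ T
  lam : ∀ y ∈ Y, y ∉ T → HasTwoNbrs G A y → y ∈ C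
  two : ∀ y ∈ C, HasTwoNbrs G A y

lemma Explored.closed_of_adj {G : SimpleGraph V} {S Y : Finset V} {u : V} {T : List V}
    {Z A C : Finset V} {n : ℕ} (h : Explored G S Y u T Z Y A C n) {y : V} (hy : y ∈ Y)
    (hyT : y ∉ T) (hyA : ∃ a ∈ A, G.Adj y a) {b : V} (hb : b ∈ S) (hyb : G.Adj y b) :
    b ∈ A ∨ b ∈ T := by
  obtain ⟨a, ha, hya⟩ := hyA
  by_cases hau : a = u
  · exact h.closed y hy hyT (.inr ⟨hy, hau ▸ hya⟩) b hb hyb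
  · exact h.closed y hy hyT (.inl ⟨a, ha, hau, hya⟩) b hb hyb

lemma Explored.attach {G : SimpleGraph V} {S Y : Finset V} (hG : IsSubcubicPair G S Y)
    {u : V} {T : List V} (hT : IsStack G S Y u T) {Z F A C W C' : Finset V} {n q : ℕ} {y : V}
    (h : Explored G S Y u T Z F A C n) (h' : PreTower G W C' y q) (hyC : y ∈ C')
    (hyu : G.Adj y u) (hWS : W ⊆ S) (hCY : C' ⊆ Y) (hW : ∀ x ∈ W, x ∉ A ∧ x ∉ Z ∧ x ∉ T)
    (hCT : ∀ x ∈ C', x ∉ T)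
    (hclosed : ∀ z ∈ Y, z ∉ T → (∃ w ∈ W, G.Adj z w) → ∀ b ∈ S, G.Adj z b →
      b ∈ W ∨ b = u ∨ b ∈ T)
    (hlam : ∀ z ∈ Y, z ∉ T → HasTwoNbrs G W z → z ∈ C') (htwo : ∀ z ∈ C', HasTwoNbrs G W z) :
    Reducible G S Y ∨ ∃ A' C'' n', Explored G S Y u T Z (insert y F) A' C'' n' := by
  have hu := h.tower.root_mem
  by_cases hbad : ∃ z ∈ Y, G.Adj z u ∧ z ∉ T ∧ z ∉ C' ∧ ∃ v ∈ W, G.Adj z v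
  · obtain ⟨z, hz, hzu, hzT, hzC, v, hv, hzv⟩ := hbad
    exact .inl (hT.reducible hG hWS hCY hv (h'.sys_end v hv) h'.card_eq hz hzT hzC hzv hzu
      (by grind) hCT htwo hlam (fun z hz hzT _ => hclosed z hz hzT))
  · have hsub := h.subset_left
    have hsub' := h.subset_right
    have hAT := h.avoid_left
    have hCT' := h.avoid_right
    have hd := hG.disj
    have hCC : ∀ z ∈ C, z ∉ C' := by
      intro z hz hz'
      obtain ⟨a, ha, b, hb, hab, hza, hzb⟩ := h.two z hz
      obtain ⟨w, hw, -, -, -, hzw, -⟩ := htwo z hz'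
      have hmeet : ∃ a ∈ A, a ≠ u ∧ G.Adj z a := by
        by_cases hau : a = u
        · exact ⟨b, hb, by grind, hzb⟩
        · exact ⟨a, ha, hau, hza⟩
      have := h.closed z (hsub' hz) (hCT' z hz) (.inl hmeet) w (hWS hw) hzw
      grind
    refine .inr ⟨A ∪ W, C ∪ C', n + q, h.tower.attach h' ?_ hyu, union_subset hsub hWS,
      union_subset hsub' hCY, ?_, ?_, ?_, ?_, ?_⟩
    · grind
    · grind
    · grind
    · intro z hz hzT hzA b hb hzb
      have hcase : (∃ w ∈ W, G.Adj z w) ∨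
          ((∃ a ∈ A, a ≠ u ∧ G.Adj z a) ∨ (z ∈ F ∧ G.Adj z u)) := by
        rcases hzA with ⟨a, ha, hau, hza⟩ | ⟨hzF, hzu⟩
        · rcases mem_union.1 ha with ha | ha
          · exact .inr (.inl ⟨a, ha, hau, hza⟩)
          · exact .inl ⟨a, ha, hza⟩
        · rcases mem_insert.1 hzF with rfl | hzF
          · obtain ⟨w, hw, -, -, -, hzw, -⟩ := htwo z hyC
            exact .inl ⟨w, hw, hzw⟩
          · exact .inr (.inr ⟨hzF, hzu⟩)
      rcases hcase with hm | hm
      · have := hclosed z hz hzT hm b hb hzb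
        grind
      · have := h.closed z hz hzT hm b hb hzb
        grind
    · rintro z hz hzT ⟨a, ha, b, hb, hab, hza, hzb⟩
      have hmix : ∀ a ∈ A, ∀ b ∈ W, G.Adj z a → G.Adj z b → z ∈ C' := by
        intro a ha b hb hza hzb
        have := hclosed z hz hzT ⟨b, hb, hzb⟩ a (hsub ha) hza
        obtain rfl : a = u := by grind
        by_contra hcon
        exact hbad ⟨z, hz, hza, hzT, hcon, b, hb, hzb⟩
      rw [mem_union]
      rcases mem_union.1 ha with ha | ha <;> rcases mem_union.1 hb with hb | hb
      · exact .inl (h.lam z hz hzT ⟨a, ha, b, hb, hab, hza, hzb⟩)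
      · exact .inr (hmix a ha b hb hza hzb)
      · exact .inr (hmix b hb a ha hzb hza)
      · exact .inr (hlam z hz hzT ⟨a, ha, b, hb, hab, hza, hzb⟩)
    · intro z hz
      rcases mem_union.1 hz with hz | hz
      · exact (h.two z hz).mono subset_union_left
      · exact (htwo z hz).mono subset_union_right

/-- `Z` is closed under passing through vertices of `Y` outside `T`. -/
def IsAvoidable (G : SimpleGraph V) (S Y : Finset V) (T : List V) (Z : Finset V) : Prop :=
  ∀ y ∈ Y, y ∉ T → (∃ z ∈ Z, G.Adj y z) → ∀ b ∈ S, G.Adj y b → b ∈ Z ∨ b ∈ T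

lemma Explored.exists_insert {G : SimpleGraph V} {S Y : Finset V} (hG : IsSubcubicPair G S Y)
    {u : V} {T : List V} (hT : IsStack G S Y u T) {Z F A C : Finset V} {n : ℕ} {y : V}
    (hZ : IsAvoidable G S Y T Z) (huZ : u ∉ Z)
    (ih : ∀ y u' Z', IsStack G S Y u' (y :: u :: T) → IsAvoidable G S Y (y :: u :: T) Z' →
      u' ∉ Z' → Reducible G S Y ∨ ∃ A C n, Explored G S Y u' (y :: u :: T) Z' Y A C n)
    (h : Explored G S Y u T Z F A C n) (hyY : y ∈ Y) :
    Reducible G S Y ∨ ∃ A' C' n', Explored G S Y u T Z (insert y F) A' C' n' := by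
  by_cases htriv : y ∉ T → G.Adj y u → ∀ b ∈ S, G.Adj y b → b ∈ A ∨ b ∈ T
  · refine .inr ⟨A, C, n, h.tower, h.subset_left, h.subset_right, h.avoid_left, h.avoid_right,
      ?_, h.lam, h.two⟩
    rintro z hz hzT (hzA | ⟨hzF, hzu⟩)
    · exact h.closed z hz hzT (.inl hzA)
    · rcases mem_insert.1 hzF with rfl | hzF
      · exact htriv hzT hzu
      · exact h.closed z hz hzT (.inr ⟨hzF, hzu⟩)
  push Not at htriv
  obtain ⟨hyT, hyu, u₁, hu₁, hyu₁, hu₁A, hu₁T⟩ := htriv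
  have hu := h.tower.root_mem
  have hd := hG.disj
  have hsub := h.subset_left
  have huT : u ∉ T := (List.nodup_cons.1 hT.nodup).1
  have hyA : ∀ a ∈ A, G.Adj y a → a = u := by
    intro a ha hya
    by_contra hau
    have := h.closed y hyY hyT (.inl ⟨a, ha, hau, hya⟩) u₁ hu₁ hyu₁
    tauto
  have hyZ : ∀ z ∈ Z, ¬ G.Adj y z := by
    intro z hz hyz
    have := hZ y hyY hyT ⟨z, hz, hyz⟩ u (hsub hu) hyu
    tauto
  have hT₁ := hT.cons_cons hG hyY hyT hyu hyu₁ hu₁ (by grind) hu₁T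
  have hZ₁ : IsAvoidable G S Y (y :: u :: T) (Z ∪ A.erase u) := by
    rintro z hz hzT ⟨a, ha, hza⟩ b hb hzb
    simp only [List.mem_cons, not_or] at hzT
    simp only [mem_union, mem_erase, List.mem_cons] at ha ⊢
    rcases ha with ha | ha
    · have := hZ z hz hzT.2.2 ⟨a, ha, hza⟩ b hb hzb
      tauto
    · have := h.closed z hz hzT.2.2 (.inl ⟨a, ha.2, ha.1, hza⟩) b hb hzb
      tauto
  obtain hR | ⟨A₁, C₁, n₁, h₁⟩ := ih y u₁ _ hT₁ hZ₁ (by grind)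
  · exact .inl hR
  have hu₁A₁ := h₁.tower.root_mem
  have hA₁ := h₁.avoid_left
  have hC₁ := h₁.avoid_right
  have hC₁Y := h₁.subset_right
  have hA₁S := h₁.subset_left
  simp only [List.mem_cons, not_or, mem_union, mem_erase, not_and] at hA₁ hC₁
  have hA₁y : y ∉ A₁ := fun hy => hd y (hA₁S hy) hyY
  have hcl₁ : ∀ z ∈ Y, z ∉ T → z ≠ y → (∃ w ∈ A₁, G.Adj z w) → ∀ b ∈ S, G.Adj z b →
      b ∈ A₁ ∨ b = u ∨ b ∈ T := by
    intro z hz hzT hzy hzw b hb hzb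
    have hzu : z ≠ u := by grind
    have := h₁.closed_of_adj hz (by simp [hzy, hzu, hzT]) hzw hb hzb
    simp only [List.mem_cons] at this
    grind
  have hlam₁ : ∀ z ∈ Y, z ∉ T → z ≠ y → HasTwoNbrs G A₁ z → z ∈ C₁ := by
    intro z hz hzT hzy hzw
    have hzu : z ≠ u := by grind
    exact h₁.lam z hz (by simp [hzy, hzu, hzT]) hzw
  by_cases ht : ∃ t ∈ A₁, t ≠ u₁ ∧ G.Adj y t
  · obtain ⟨t, htA, htu, hyt⟩ := ht
    have hy3 : ∀ b, G.Adj y b → b = u ∨ b = u₁ ∨ b = t := by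
      intro b hyb
      by_contra hcon
      exact hG.not_four y hyY u u₁ t b hyu hyu₁ hyt hyb (by grind) (by grind) (by grind)
        (by grind) (by grind) (by grind)
    refine h.attach hG hT (h₁.tower.preTower hA₁y (by grind) htA htu hyu₁ hyt)
      (mem_insert_self _ _) hyu hA₁S ?_ ?_ ?_ ?_ ?_ ?_
    · grind
    · grind
    · grind
    · intro z hz hzT hzw b hb hzb
      by_cases hzy : z = y
      · subst hzy
        have := hy3 b hzb
        grind
      · exact hcl₁ z hz hzT hzy hzw b hb hzb
    · intro z hz hzT hzw
      by_cases hzy : z = y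
      · simp [hzy]
      · exact mem_insert_of_mem (hlam₁ z hz hzT hzy hzw)
    · intro z hz
      rcases mem_insert.1 hz with rfl | hz
      · exact ⟨u₁, hu₁A₁, t, htA, htu.symm, hyu₁, hyt⟩
      · exact h₁.two z hz
  have hyA₁ : ∀ t ∈ A₁, G.Adj y t → t = u₁ := by
    intro t htA hyt
    by_contra hcon
    exact ht ⟨t, htA, hcon, hyt⟩
  by_cases hu₂ : ∃ u₂ ∈ S, G.Adj y u₂ ∧ u₂ ≠ u ∧ u₂ ≠ u₁ ∧ u₂ ∉ T
  · obtain ⟨u₂, hu₂, hyu₂, hu₂u, hu₂u₁, hu₂T⟩ := hu₂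
    have hy3 : ∀ b, G.Adj y b → b = u ∨ b = u₁ ∨ b = u₂ := by
      intro b hyb
      by_contra hcon
      exact hG.not_four y hyY u u₁ u₂ b hyu hyu₁ hyu₂ hyb (by grind) (by grind) (by grind)
        (by grind) (by grind) (by grind)
    have hZ₂ : IsAvoidable G S Y (y :: u :: T) (Z ∪ A.erase u ∪ A₁) := by
      rintro z hz hzT ⟨a, ha, hza⟩ b hb hzb
      rcases mem_union.1 ha with ha | ha
      · have := hZ₁ z hz hzT ⟨a, ha, hza⟩ b hb hzb
        grind
      · have := h₁.closed_of_adj hz hzT ⟨a, ha, hza⟩ hb hzb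
        grind
    obtain hR | ⟨A₂, C₂, n₂, h₂⟩ := ih y u₂ _
      (hT.cons_cons hG hyY hyT hyu hyu₂ hu₂ hu₂u hu₂T) hZ₂ (by grind)
    · exact .inl hR
    have hu₂A₂ := h₂.tower.root_mem
    have hA₂ := h₂.avoid_left
    have hC₂ := h₂.avoid_right
    have hC₂Y := h₂.subset_right
    have hA₂S := h₂.subset_left
    simp only [List.mem_cons, not_or, mem_union, mem_erase, not_and] at hA₂ hC₂
    have hA₂y : y ∉ A₂ := fun hy => hd y (hA₂S hy) hyY
    have hmix : ∀ z ∈ Y, z ∉ T → z ≠ y → ∀ a ∈ A₁, ∀ b ∈ A₂, G.Adj z a → G.Adj z b →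
        False := by
      intro z hz hzT hzy a ha b hb hza hzb
      have := hcl₁ z hz hzT hzy ⟨a, ha, hza⟩ b (hA₂S hb) hzb
      have := hA₂ b hb
      tauto
    have hCC : ∀ z ∈ C₁, z ∉ C₂ := by
      intro z hz hz'
      obtain ⟨a, ha, -, -, -, hza, -⟩ := h₁.two z hz
      obtain ⟨b, hb, -, -, -, hzb, -⟩ := h₂.two z hz'
      exact hmix z (hC₁Y hz) (hC₁ z hz).2.2 (hC₁ z hz).1 a ha b hb hza hzb
    refine h.attach hG hT (h₁.tower.preTower_pair h₂.tower ?_ ?_ ?_ hyu₁ hyu₂)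
      (mem_insert_self _ _) hyu (union_subset hA₁S hA₂S) ?_ ?_ ?_ ?_ ?_ ?_
    · grind
    · grind
    · grind
    · grind
    · grind
    · grind
    · intro z hz hzT hzw b hb hzb
      by_cases hzy : z = y
      · subst hzy
        have := hy3 b hzb
        grind
      · obtain ⟨w, hw, hzw⟩ := hzw
        rcases mem_union.1 hw with hw | hw
        · have := hcl₁ z hz hzT hzy ⟨w, hw, hzw⟩ b hb hzb
          grind
        · have hzu : z ≠ u := by grind
          have := h₂.closed_of_adj hz (by simp [hzy, hzu, hzT]) ⟨w, hw, hzw⟩ hb hzb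
          simp only [List.mem_cons] at this
          grind
    · rintro z hz hzT ⟨a, ha, b, hb, hab, hza, hzb⟩
      by_cases hzy : z = y
      · simp [hzy]
      · have hzu : z ≠ u := by grind
        refine mem_insert_of_mem (mem_union.2 ?_)
        rcases mem_union.1 ha with ha | ha <;> rcases mem_union.1 hb with hb | hb
        · exact .inl (hlam₁ z hz hzT hzy ⟨a, ha, b, hb, hab, hza, hzb⟩)
        · exact (hmix z hz hzT hzy a ha b hb hza hzb).elim
        · exact (hmix z hz hzT hzy b hb a ha hzb hza).elim
        · exact .inr (h₂.lam z hz (by simp [hzy, hzu, hzT]) ⟨a, ha, b, hb, hab, hza, hzb⟩)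
    · intro z hz
      rcases mem_insert.1 hz with rfl | hz
      · exact ⟨u₁, mem_union_left _ hu₁A₁, u₂, mem_union_right _ hu₂A₂, hu₂u₁.symm, hyu₁, hyu₂⟩
      · rcases mem_union.1 hz with hz | hz
        · exact (h₁.two z hz).mono subset_union_left
        · exact (h₂.two z hz).mono subset_union_right
  · push Not at hu₂
    refine .inl (hT.reducible hG hA₁S hC₁Y hu₁A₁ (h₁.tower.sys_end hu₁A₁) ?_ hyY hyT
      (fun hy => (hC₁ y hy).1 rfl) hyu₁ hyu ?_ ?_ h₁.two ?_ ?_)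
    · rw [h₁.tower.card_eq, Nat.add_assoc]
    · grind
    · grind
    · intro z hz hzT hzw
      by_cases hzy : z = y
      · subst hzy
        obtain ⟨a, ha, b, hb, hab, hza, hzb⟩ := hzw
        exact (hab ((hyA₁ a ha hza).trans (hyA₁ b hb hzb).symm)).elim
      · exact hlam₁ z hz hzT hzy hzw
    · intro z hz hzT hzC hzw b hb hzb
      by_cases hzy : z = y
      · subst hzy
        have := hu₂ b hb hzb
        grind
      · exact hcl₁ z hz hzT hzy hzw b hb hzb

lemma IsStack.reducible_or_explored {G : SimpleGraph V} {S Y : Finset V}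
    (hG : IsSubcubicPair G S Y) {u : V} {T : List V} {Z : Finset V} (hT : IsStack G S Y u T)
    (hZ : IsAvoidable G S Y T Z) (huZ : u ∉ Z) :
    Reducible G S Y ∨ ∃ A C n, Explored G S Y u T Z Y A C n := by
  induction hm : (S.filter fun x => x ∉ u :: T).card using Nat.strong_induction_on
    generalizing u T Z with
  | _ m ih =>
    have key : ∀ F ⊆ Y, Reducible G S Y ∨ ∃ A C n, Explored G S Y u T Z F A C n := by
      intro F
      induction F using Finset.induction_on with
      | empty =>
        refine fun _ => .inr ⟨{u}, ∅, 0, Tower.singleton G u, by simpa using hT.head_mem,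
          by simp, ?_, by simp, by simp, ?_, by simp⟩
        · simpa using ⟨(List.nodup_cons.1 hT.nodup).1, huZ⟩
        · rintro y - - ⟨a, ha, b, hb, hab, -⟩
          exact (hab ((mem_singleton.1 ha).trans (mem_singleton.1 hb).symm)).elim
      | insert y F hy ihF =>
        intro hF
        obtain ⟨hyY, hF⟩ := insert_subset_iff.1 hF
        obtain hR | ⟨A, C, n, h⟩ := ihF hF
        · exact .inl hR
        · refine h.exists_insert hG hT hZ huZ ?_ hyY
          intro y u' Z' hT' hZ' hu'
          refine ih _ ?_ hT' hZ' hu' rfl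
          rw [← hm]
          refine card_lt_card (ssubset_iff_of_subset ?_ |>.2 ⟨u', ?_, ?_⟩)
          · intro x hx
            simp only [mem_filter, List.mem_cons] at hx ⊢
            tauto
          · have := (List.nodup_cons.1 hT'.nodup).1
            simp only [mem_filter, List.mem_cons] at this ⊢
            exact ⟨hT'.head_mem, by tauto⟩
          · simp
    exact key Y subset_rfl

lemma IsSubcubicPair.reducible {G : SimpleGraph V} {S Y : Finset V}
    (hG : IsSubcubicPair G S Y) (hS : S.Nonempty) : Reducible G S Y := by
  obtain ⟨u, hu⟩ := hS
  have hT : IsStack G S Y u [] := ⟨by simp, by simp, hu, by simp, by simp⟩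
  obtain hR | ⟨A, C, n, h⟩ := hT.reducible_or_explored hG (Z := ∅)
    (by simp [IsAvoidable]) (by simp)
  · exact hR
  · have hle : (lamSet G Y A).card ≤ C.card := card_le_card fun y hy =>
      h.lam y (mem_lamSet.1 hy).1 (by simp) (mem_lamSet.1 hy).2
    have hcard := h.tower.card_eq
    refine ⟨A, A, C, n + 1, h.subset_left, ⟨u, h.tower.root_mem⟩, subset_rfl, h.subset_right,
      (h.tower.sys_end h.tower.root_mem).pathSys, h.two, by omega, ?_⟩
    intro y hy _ hyA b hb hyb
    simpa using h.closed_of_adj hy (by simp) hyA hb hyb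

lemma IsSubcubicPair.exists_pathSys {G : SimpleGraph V} {S Y : Finset V}
    (hG : IsSubcubicPair G S Y) : ∃ k C S', PathSys G k (S ∪ C) ∧ C ⊆ Y ∧
      (∀ y ∈ C, HasTwoNbrs G S y) ∧ S' ⊆ S ∧ k + (lamSet G Y S').card ≤ S'.card := by
  induction S using Finset.strongInduction with
  | _ S ih =>
    rcases S.eq_empty_or_nonempty with rfl | hS
    · refine ⟨0, ∅, ∅, by simpa using PathSys.empty G, by simp, by simp, by simp, ?_⟩
      simp [lamSet]
    obtain ⟨B, B', C, k, hBS, hB, hB', hCY, hsys, htwo, hk, hcl⟩ := hG.reducible hS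
    have hG' : IsSubcubicPair G (S \ B) Y :=
      ⟨fun x hx => hG.disj x (mem_sdiff.1 hx).1, hG.not_four⟩
    obtain ⟨k', C', S', hsys', hCY', htwo', hS', hk'⟩ := ih _ (sdiff_ssubset hBS hB) hG'
    have hd := hG.disj
    have hCC : ∀ z ∈ C, z ∉ C' := by
      intro z hz hz'
      obtain ⟨a, ha, b, hb, hab, hza, hzb⟩ := htwo z hz
      obtain ⟨c, hc, d, hd, hcd, hzc, hzd⟩ := htwo' z hz'
      exact hG.not_four z (hCY hz) a b c d hza hzb hzc hzd hab (by grind) (by grind)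
        (by grind) (by grind) hcd
    have hlam : lamSet G Y (B' ∪ S') ⊆ lamSet G Y B' ∪ lamSet G Y S' := by
      intro z hz
      obtain ⟨hzY, a, ha, b, hb, hab, hza, hzb⟩ := mem_lamSet.1 hz
      by_contra hcon
      simp only [mem_union, not_or] at hcon
      by_cases hm : ∃ b ∈ B', G.Adj z b
      · have := hcl z hzY hcon.1 hm
        refine hcon.1 (mem_lamSet.2 ⟨hzY, a, ?_, b, ?_, hab, hza, hzb⟩) <;> grind
      · refine hcon.2 (mem_lamSet.2 ⟨hzY, a, ?_, b, ?_, hab, hza, hzb⟩) <;> grind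
    refine ⟨k + k', C ∪ C', B' ∪ S', hsys.union hsys' ?_ ?_ rfl, union_subset hCY hCY', ?_, ?_,
      ?_⟩
    · grind
    · grind
    · intro z hz
      rcases mem_union.1 hz with hz | hz
      · exact (htwo z hz).mono hBS
      · exact (htwo' z hz).mono sdiff_subset
    · grind
    · have h1 := (card_le_card hlam).trans (card_union_le _ _)
      have h2 : (B' ∪ S').card = B'.card + S'.card :=
        card_union_of_disjoint (disjoint_left.2 fun x hx hx' => by grind)
      omega

lemma IsPathList.exists_walks {G : SimpleGraph V} {L : List (List V)} (h : IsPathList G L) :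
    ∃ P : List (Σ u : V, Σ v : V, G.Walk u v),
      (∀ p ∈ P, p.2.2.IsPath) ∧ P.map (fun p => p.2.2.support) = L := by
  induction L with
  | nil => exact ⟨[], by simp⟩
  | cons l L ih =>
    obtain ⟨hne, hc, hn, -, hL⟩ := isPathList_cons.1 h
    obtain ⟨P, hP, hPL⟩ := ih hL
    refine ⟨⟨_, _, Walk.ofSupport l hne hc⟩ :: P, ?_, ?_⟩
    · rintro p hp
      rcases List.mem_cons.1 hp with rfl | hp
      · rw [Walk.isPath_def]
        simpa [Walk.support_ofSupport] using hn
      · exact hP p hp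
    · simp [Walk.support_ofSupport, hPL]

lemma PathSys.isPathExactCover {G : SimpleGraph V} {X S C : Finset V} {k : ℕ}
    (h : PathSys G k (S ∪ C)) (hC : Disjoint X C) :
    ∃ P, IsPathExactCover G X S P ∧ P.length = k := by
  obtain ⟨L, hL, hLS, hk⟩ := h
  obtain ⟨P, hP, hPL⟩ := hL.exists_walks
  refine ⟨P, ⟨hP, ?_, ?_⟩, by rw [← hk, ← hPL, List.length_map]⟩
  · have := (List.nodup_flatten.1 hL.2).2
    rw [← hPL, List.pairwise_map] at this
    exact this.imp fun h w hw hw' => h hw hw'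
  · intro x hx
    have hxC := disjoint_left.1 hC hx
    have : x ∈ S ↔ x ∈ L.flatten := by
      rw [← hLS, mem_union]
      tauto
    rw [this, ← hPL]
    simp

lemma lamDefSet_le_lamDef (G : SimpleGraph V) {X Y S : Finset V} (hS : S ⊆ X) :
    lamDefSet G Y S ≤ lamDef G X Y :=
  le_sup' (fun S => lamDefSet G Y S) (mem_powerset.2 hS)

lemma isSubcubicPair_of_degree_le [Fintype V] {G : SimpleGraph V} [DecidableRel G.Adj]
    {S Y : Finset V} (hd : Disjoint S Y) (hdeg : ∀ v, G.degree v ≤ 3) :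
    IsSubcubicPair G S Y := by
  refine ⟨fun x hx => disjoint_left.1 hd hx, ?_⟩
  intro y _ a b c d ha hb hc hd hab hac had hbc hbd hcd
  have hsub : ({a, b, c, d} : Finset V) ⊆ G.neighborFinset y := by
    intro x hx
    rw [mem_neighborFinset]
    grind
  have h4 : ({a, b, c, d} : Finset V).card = 4 := by
    grind
  have := card_le_card hsub
  have := hdeg y
  rw [card_neighborFinset_eq_degree] at *
  omega

/-- If `G` is an `(X,Y)`-bigraph with maximum degree at most
`3`, then for every `S ⊆ X` there is a set of at most `def(G)` pairwise
vertex-disjoint paths whose union of vertex sets intersects `X` exactly in `S`. -/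
theorem maxDegree_three_exact_cover {V : Type*} [Fintype V] (G : SimpleGraph V)
    [DecidableRel G.Adj] (X Y : Finset V) (hBG : IsBigraph G X Y)
    (hdeg : ∀ v : V, G.degree v ≤ 3) :
    ∀ S ⊆ X, ∃ P : List (Σ u : V, Σ v : V, G.Walk u v),
      IsPathExactCover G X S P ∧ (P.length : ℤ) ≤ lamDef G X Y := by
  intro S hS
  have hSY : Disjoint S Y := disjoint_of_subset_left hS hBG.1
  obtain ⟨k, C, S', hsys, hCY, -, hS', hk⟩ :=
    (isSubcubicPair_of_degree_le hSY hdeg).exists_pathSys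
  obtain ⟨P, hP, hlen⟩ := hsys.isPathExactCover (disjoint_of_subset_right hCY hBG.1)
  refine ⟨P, hP, le_trans ?_ (lamDefSet_le_lamDef G (hS'.trans hS))⟩
  rw [lamDefSet, hlen]
  omega
end

section
/- (Lovász Local Lemma, general form) Let A_1, A_2, …, A_N be events in a probability space and let D = (V,E) be a dependency digraph for A_1, …, A_N on vertex set V = {1, …, N}: for each i, the event A_i is mutually independent of the family of events {A_j : j ≠ i and (i,j) ∉ E}, meaning that for every subset J of {j : j ≠ i, (i,j) ∉ E}, P(A_i ∩ ⋂_{j∈J} A_j) = P(A_i) · P(⋂_{j∈J} A_j). Suppose there are real numbers x_1, …, x_N with 0 ≤ x_i < 1 and P(A_i) ≤ x_i · ∏_{(i,j)∈E} (1 − x_j) for all i. Then P(⋂_{i=1}^N A_i^c) ≥ ∏_{i=1}^N (1 − x_i); in particular, with positive probability no event A_i holds. -/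
open MeasureTheory Finset
open scoped Classical

section LocalLemma

variable {Ω ι : Type*} [MeasurableSpace Ω] {μ : Measure Ω} {A : ι → Set Ω}

theorem measureReal_biInter_compl_insert_inter [IsFiniteMeasure μ]
    (hA : ∀ i, MeasurableSet (A i)) (a : ι) (S : Finset ι) (C : Set Ω) :
    μ.real ((⋂ j ∈ insert a S, (A j)ᶜ) ∩ C) =
      μ.real ((⋂ j ∈ S, (A j)ᶜ) ∩ C) - μ.real ((⋂ j ∈ S, (A j)ᶜ) ∩ (A a ∩ C)) := by
  have h := measureReal_inter_add_sdiff (μ := μ) (s := (⋂ j ∈ S, (A j)ᶜ) ∩ C) (hA a)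
  have h₁ : ((⋂ j ∈ S, (A j)ᶜ) ∩ C) ∩ A a = (⋂ j ∈ S, (A j)ᶜ) ∩ (A a ∩ C) := by
    rw [Set.inter_assoc, Set.inter_comm C]
  have h₂ : ((⋂ j ∈ S, (A j)ᶜ) ∩ C) \ A a = (⋂ j ∈ insert a S, (A j)ᶜ) ∩ C := by
    rw [Finset.set_biInter_insert, Set.sdiff_eq, Set.inter_comm _ (A a)ᶜ, Set.inter_assoc]
  rw [h₁, h₂] at h
  linarith

/-- An event `D` independent of all intersections of the events `A j`, `j ∈ K`, is also independent
of all intersections of these events and their complements. -/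
theorem measureReal_inter_biInter_compl [IsFiniteMeasure μ] (hA : ∀ i, MeasurableSet (A i))
    {D : Set Ω} {K : Set ι}
    (hD : ∀ J : Finset ι, (∀ j ∈ J, j ∈ K) →
      μ.real (D ∩ ⋂ j ∈ J, A j) = μ.real D * μ.real (⋂ j ∈ J, A j))
    (S : Finset ι) (hS : ∀ j ∈ S, j ∈ K) (J : Finset ι) (hJ : ∀ j ∈ J, j ∈ K) :
    μ.real ((⋂ j ∈ S, (A j)ᶜ) ∩ (D ∩ ⋂ j ∈ J, A j)) =
      μ.real D * μ.real ((⋂ j ∈ S, (A j)ᶜ) ∩ ⋂ j ∈ J, A j) := by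
  induction S using Finset.induction_on generalizing J with
  | empty => simpa using hD J hJ
  | insert a S _ ih =>
    have hS' : ∀ j ∈ S, j ∈ K := fun j hj => hS j (mem_insert_of_mem hj)
    have haJ : ∀ j ∈ insert a J, j ∈ K := by
      intro j hj
      rcases mem_insert.1 hj with rfl | hj
      · exact hS j (mem_insert_self j S)
      · exact hJ j hj
    have h := ih hS' (insert a J) haJ
    rw [Finset.set_biInter_insert, Set.inter_left_comm D] at h
    rw [measureReal_biInter_compl_insert_inter hA, measureReal_biInter_compl_insert_inter hA,
      ih hS' J hJ, h, mul_sub]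

theorem prod_mul_measureReal_biInter_compl_le [IsFiniteMeasure μ]
    (hA : ∀ i, MeasurableSet (A i)) {x : ι → ℝ} (hx1 : ∀ i, x i < 1) (T U : Finset ι)
    (hTU : Disjoint T U)
    (h : ∀ R : Finset ι, #R < #(T ∪ U) → ∀ a ∉ R,
      μ.real ((⋂ j ∈ R, (A j)ᶜ) ∩ A a) ≤ x a * μ.real (⋂ j ∈ R, (A j)ᶜ)) :
    (∏ j ∈ T, (1 - x j)) * μ.real (⋂ j ∈ U, (A j)ᶜ) ≤ μ.real (⋂ j ∈ T ∪ U, (A j)ᶜ) := by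
  induction T using Finset.induction_on with
  | empty => simp
  | insert a T ha ih =>
    rw [disjoint_insert_left] at hTU
    have haR : a ∉ T ∪ U := by simp [ha, hTU.1]
    rw [insert_union, card_insert_of_notMem haR] at h
    have ih' := ih hTU.2 fun R hR => h R (by omega)
    have hstep := h (T ∪ U) (by omega) a haR
    have hsplit := measureReal_biInter_compl_insert_inter (μ := μ) hA a (T ∪ U) Set.univ
    simp only [Set.inter_univ] at hsplit
    rw [insert_union, hsplit, prod_insert ha, mul_assoc]
    linarith [mul_le_mul_of_nonneg_left ih' (sub_nonneg.2 (hx1 a).le)]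

/-- The conditional probability bound at the heart of the local lemma, in product form: conditioned
on no event of `S` occurring, `A i` has probability at most `x i`. -/
theorem measureReal_biInter_compl_inter_le [Fintype ι] [IsFiniteMeasure μ]
    (hA : ∀ i, MeasurableSet (A i)) {E : ι → ι → Prop}
    (hdep : ∀ (i : ι) (J : Finset ι), (∀ j ∈ J, j ≠ i ∧ ¬E i j) →
      μ.real (A i ∩ ⋂ j ∈ J, A j) = μ.real (A i) * μ.real (⋂ j ∈ J, A j))
    {x : ι → ℝ} (hx0 : ∀ i, 0 ≤ x i) (hx1 : ∀ i, x i < 1)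
    (hbound : ∀ i, μ.real (A i) ≤ x i * ∏ j ∈ univ.filter (fun j => E i j), (1 - x j))
    (S : Finset ι) (i : ι) (hi : i ∉ S) :
    μ.real ((⋂ j ∈ S, (A j)ᶜ) ∩ A i) ≤ x i * μ.real (⋂ j ∈ S, (A j)ᶜ) := by
  induction hn : #S using Nat.strong_induction_on generalizing S i with
  | _ n ih =>
    set T := S.filter fun j => E i j
    set U := S.filter fun j => ¬E i j
    have hTU : T ∪ U = S := filter_union_filter_not_eq _ S
    have hU : ∀ j ∈ U, j ≠ i ∧ ¬E i j := by
      intro j hj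
      obtain ⟨hjS, hjE⟩ := mem_filter.1 hj
      exact ⟨fun h => hi (h ▸ hjS), hjE⟩
    have hchain := prod_mul_measureReal_biInter_compl_le (μ := μ) hA hx1 T U
      (disjoint_filter_filter_not S S _)
      (fun R hR a ha => ih #R (by rwa [hTU, hn] at hR) R a ha rfl)
    rw [hTU] at hchain
    have hindep := measureReal_inter_biInter_compl hA (K := {j | j ≠ i ∧ ¬E i j}) (hdep i) U hU
      ∅ (by simp)
    simp only [notMem_empty, Set.iInter_of_empty, Set.iInter_univ, Set.inter_univ] at hindep
    have hprod : ∏ j ∈ univ.filter (fun j => E i j), (1 - x j) ≤ ∏ j ∈ T, (1 - x j) :=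
      prod_le_prod_of_subset_of_le_one (filter_subset_filter _ (subset_univ S))
        (fun j _ => sub_nonneg.2 (hx1 j).le) (fun j _ _ => sub_le_self _ (hx0 j))
    calc μ.real ((⋂ j ∈ S, (A j)ᶜ) ∩ A i)
        ≤ μ.real ((⋂ j ∈ U, (A j)ᶜ) ∩ A i) :=
          measureReal_mono (Set.inter_subset_inter_left _
            (Set.biInter_subset_biInter_left (filter_subset _ S)))
      _ = μ.real (A i) * μ.real (⋂ j ∈ U, (A j)ᶜ) := hindep
      _ ≤ x i * (∏ j ∈ T, (1 - x j)) * μ.real (⋂ j ∈ U, (A j)ᶜ) := by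
          gcongr
          exact (hbound i).trans (mul_le_mul_of_nonneg_left hprod (hx0 i))
      _ ≤ x i * μ.real (⋂ j ∈ S, (A j)ᶜ) := by
          rw [mul_assoc]
          exact mul_le_mul_of_nonneg_left hchain (hx0 i)

end LocalLemma

/-- (Lovász Local Lemma, general form.) Let `A 1, …, A N` be
events and `E` a dependency digraph for them: each `A i` is mutually
independent of the family `{A j : j ≠ i, (i,j) ∉ E}`. If there are reals
`0 ≤ x i < 1` with `P(A i) ≤ x i * ∏_{(i,j) ∈ E} (1 − x j)` for all `i`, then
`P(⋂ i, (A i)ᶜ) ≥ ∏ i (1 − x i)`. -/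
theorem lovasz_local_lemma {Ω : Type*} [MeasurableSpace Ω] (μ : Measure Ω)
    [IsProbabilityMeasure μ] (N : ℕ) (A : Fin N → Set Ω)
    (hA : ∀ i, MeasurableSet (A i))
    (E : Fin N → Fin N → Prop)
    (hdep : ∀ (i : Fin N) (J : Finset (Fin N)),
      (∀ j ∈ J, j ≠ i ∧ ¬E i j) →
      μ (A i ∩ ⋂ j ∈ J, A j) = μ (A i) * μ (⋂ j ∈ J, A j))
    (x : Fin N → ℝ) (hx0 : ∀ i, 0 ≤ x i) (hx1 : ∀ i, x i < 1)
    (hbound : ∀ i, (μ (A i)).toReal ≤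
      x i * ∏ j ∈ Finset.univ.filter (fun j => E i j), (1 - x j)) :
    ∏ i, (1 - x i) ≤ (μ (⋂ i, (A i)ᶜ)).toReal := by
  have hdep' : ∀ (i : Fin N) (J : Finset (Fin N)), (∀ j ∈ J, j ≠ i ∧ ¬E i j) →
      μ.real (A i ∩ ⋂ j ∈ J, A j) = μ.real (A i) * μ.real (⋂ j ∈ J, A j) := fun i J hJ => by
    simp only [measureReal_def, hdep i J hJ, ENNReal.toReal_mul]
  have h := prod_mul_measureReal_biInter_compl_le (μ := μ) hA hx1 univ ∅ (disjoint_empty_right _)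
    fun R _ a ha => measureReal_biInter_compl_inter_le hA hdep' hx0 hx1 hbound R a ha
  simpa [measureReal_def] using h
end

section
/- For every real number x ≥ 0, one has (1 − 1/(2x+1))^x ≥ e^{−1/2}, where the left side is the real power with exponent x. -/
/-- For every real `x ≥ 0`,
`(1 − 1/(2x+1))^x ≥ e^{−1/2}` (real power). -/
theorem one_sub_inv_two_x_add_one_rpow_ge (x : ℝ) (hx : 0 ≤ x) :
    Real.exp (-(1 / 2)) ≤ (1 - 1 / (2 * x + 1)) ^ x := by
  rcases hx.eq_or_lt with rfl | hx
  · simp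
  have hb : 1 - 1 / (2 * x + 1) = 2 * x / (2 * x + 1) := by
    field_simp
    ring
  have hpos : 0 < 2 * x / (2 * x + 1) := by positivity
  rw [hb, Real.rpow_def_of_pos hpos, Real.exp_le_exp]
  calc -(1 / 2) = (1 - (2 * x / (2 * x + 1))⁻¹) * x := by
        field_simp
        ring
    _ ≤ Real.log (2 * x / (2 * x + 1)) * x :=
        mul_le_mul_of_nonneg_right (Real.one_sub_inv_le_log_of_pos hpos) hx.le
end
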